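/- Let β ∈ (0,∞) and h ∈ ℝ. (i) If P_{β,h}^{+,+} = P_{β,h}^{+,−}, then the Schonmann projection ν_{β,h}^+ is a regular g-measure (consistent with a continuous, (0,1)-valued g-function). (ii) If ν_{β,h}^+ is a g-measure consistent with P_{β,h}^{+,−}, then P_{β,h}^{+,+}(a|ω) = P_{β,h}^{+,−}(a|ω) for ν_{β,h}^+-almost every past ω and ν_{β,h}^+ is an almost regular g-measure. -/

import Mathlib

open MeasureTheory Filter Topology ProbabilityTheory

noncomputable section

/-- Spin value of a Boolean spin: `true ↦ +1`, `false ↦ -1`. -/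
def sval (b : Bool) : ℝ := if b then 1 else -1

/-- Two-dimensional spin configurations. -/
abbrev Cfg2 := ℤ × ℤ → Bool

/-- Two-sided sequences over an alphabet `A`. -/
abbrev ZSeq (A : Type*) := ℤ → A

/-- Pasts: index `k` corresponds to the coordinate `-(k+1)`. -/
abbrev Past (A : Type*) := ℕ → A

/-- The four nearest neighbours of a site of `ℤ²`. -/
def nbrs (x : ℤ × ℤ) : Finset (ℤ × ℤ) :=
  {(x.1 + 1, x.2), (x.1 - 1, x.2), (x.1, x.2 + 1), (x.1, x.2 - 1)}

/-- Boltzmann weight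
`exp(β[Σ_{{x,y}⊆Λ, x∼y} ω_x ω_y + Σ_{x∈Λ, y∉Λ, x∼y} ω_x σ_y] − h Σ_{x∈Λ} ω_x)`
(the sum over unordered pairs inside `Λ` is written as half the ordered sum). -/
def isingWeight (β h : ℝ) (Λ : Finset (ℤ × ℤ)) (σ ω : Cfg2) : ℝ :=
  Real.exp (β * ((∑ x ∈ Λ, ∑ y ∈ Λ.filter (fun y => y ∈ nbrs x),
        sval (ω x) * sval (ω y)) / 2
      + ∑ x ∈ Λ, ∑ y ∈ (nbrs x).filter (fun y => y ∉ Λ), sval (ω x) * sval (σ y))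
    - h * ∑ x ∈ Λ, sval (ω x))

/-- Fill in the values `τ` inside `Λ` and `σ` outside. -/
def fill (Λ : Finset (ℤ × ℤ)) (σ : Cfg2) (τ : ↥Λ → Bool) : Cfg2 :=
  fun x => if hx : x ∈ Λ then τ ⟨x, hx⟩ else σ x

/-- The finite-volume Ising measure in `Λ` with boundary condition `σ`, viewed as a measure on
the full configuration space, the spins outside `Λ` being frozen to `σ`. -/
def isingFV (β h : ℝ) (Λ : Finset (ℤ × ℤ)) (σ : Cfg2) : Measure Cfg2 :=
  (∑ τ : ↥Λ → Bool, ENNReal.ofReal (isingWeight β h Λ σ (fill Λ σ τ)))⁻¹ •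
    ∑ τ : ↥Λ → Bool,
      ENNReal.ofReal (isingWeight β h Λ σ (fill Λ σ τ)) • Measure.dirac (fill Λ σ τ)

/-- The box `[-n,n]²`. -/
def box (n : ℕ) : Finset (ℤ × ℤ) :=
  (Finset.Icc (-(n : ℤ)) (n : ℤ)) ×ˢ (Finset.Icc (-(n : ℤ)) (n : ℤ))

/-- Convergence of a sequence of measures on a product space in the sense of convergence of the
measures of all finite-dimensional cylinder events; for probability measures on `{−1,+1}^ι`
this is exactly weak convergence. -/
def CylTendsto {ι A : Type*} [MeasurableSpace A] (μs : ℕ → Measure (ι → A))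
    (μ : Measure (ι → A)) : Prop :=
  ∀ (s : Finset ι) (f : ι → A),
    Tendsto (fun n => μs n {η | ∀ i ∈ s, η i = f i}) atTop (𝓝 (μ {η | ∀ i ∈ s, η i = f i}))

/-- `μ` is the plus phase `μ_{β,h}^+`: the weak limit of the finite-volume Ising measures on
`[-n,n]²` with all-plus boundary conditions. -/
def IsPlusPhase (β h : ℝ) (μ : Measure Cfg2) : Prop :=
  IsProbabilityMeasure μ ∧ CylTendsto (fun n => isingFV β h (box n) (fun _ => true)) μ

/-- `μ` is the minus phase `μ_{β,h}^-`. -/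
def IsMinusPhase (β h : ℝ) (μ : Measure Cfg2) : Prop :=
  IsProbabilityMeasure μ ∧ CylTendsto (fun n => isingFV β h (box n) (fun _ => false)) μ

/-- The critical inverse temperature `β_c = ln(1+√2)/2`. -/
def betaCrit : ℝ := Real.log (1 + Real.sqrt 2) / 2

/-- Projection of a two-dimensional configuration onto the line `ℤ × {0}`. -/
def lineProj (η : Cfg2) : ZSeq Bool := fun i => η (i, 0)

/-- The Schonmann projection of a measure on `{−1,+1}^{ℤ²}`. -/
def schonmann (μ : Measure Cfg2) : Measure (ZSeq Bool) := μ.map lineProj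

/-- Restriction of a two-sided sequence to its strict past; index `k` is coordinate `-(k+1)`. -/
def restrictPast {A : Type*} (ω : ZSeq A) : Past A := fun k => ω (-(k + 1 : ℤ))

/-- The shift on two-sided sequences. -/
def shiftSeq {A : Type*} : ZSeq A → ZSeq A := fun ω i => ω (i + 1)

/-- The σ-algebra `ℱ_{<0}` generated by the coordinates of negative index. -/
def pastSigma (A : Type*) [MeasurableSpace A] : MeasurableSpace (ZSeq A) :=
  MeasurableSpace.comap (fun ω : ZSeq A => restrictPast ω) inferInstance

/-- The σ-algebra generated by the coordinates in `S`. -/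
def sigmaOn {ι A : Type*} [MeasurableSpace A] (S : Set ι) : MeasurableSpace (ι → A) :=
  MeasurableSpace.comap (fun ω : ι → A => S.restrict ω) inferInstance

/-- A g-function on the alphabet `A`: measurable, `[0,1]`-valued, normalized. -/
def IsGFunction {A : Type*} [Fintype A] [MeasurableSpace A] (P : A → Past A → ℝ) : Prop :=
  (∀ a, Measurable (P a)) ∧ ∀ ω, (∑ a : A, P a ω) = 1 ∧ ∀ a, P a ω ∈ Set.Icc (0 : ℝ) 1

/-- `μ` is a translation-invariant g-measure consistent with the g-function `P`: for each `a`,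
`ω ↦ P a (restrictPast ω)` is a version of the conditional probability `μ(X₀ = a | ℱ_{<0})`. -/
def IsGMeasure {A : Type*} [MeasurableSpace A] (μ : Measure (ZSeq A))
    (P : A → Past A → ℝ) : Prop :=
  IsProbabilityMeasure μ ∧ μ.map shiftSeq = μ ∧
    ∀ a : A, (fun ω => P a (restrictPast ω))
      =ᵐ[μ] μ[Set.indicator {ω : ZSeq A | ω 0 = a} (fun _ => (1 : ℝ)) | pastSigma A]

/-- The `k`-th variation of a g-function: the supremum of `|P a ω − P a σ|` over pasts agreeing
on the coordinates `−k,…,−1`. -/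
def varG {A : Type*} (P : A → Past A → ℝ) (k : ℕ) : ℝ :=
  sSup {d : ℝ | ∃ (a : A) (ω σ' : Past A), (∀ j < k, ω j = σ' j) ∧ d = |P a ω - P a σ'|}

/-- Elementary conditional probability `μ(B | A)`, as a real number. -/
def condProbR {X : Type*} [MeasurableSpace X] (μ : Measure X) (B A : Set X) : ℝ :=
  ((μ[|A]) B).toReal

/-- The event that `η_i = ω` (suitably reindexed) for `−n ≤ i ≤ −1` and `η_i = b`
for `−(n+l) ≤ i ≤ −(n+1)`. -/
def pastEvt (n l : ℕ) (b : Bool) (ω : Past Bool) : Set (ZSeq Bool) :=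
  {η | (∀ i : ℤ, -(n : ℤ) ≤ i → i ≤ -1 → η i = ω (i.natAbs - 1)) ∧
       (∀ i : ℤ, -((n : ℤ) + l) ≤ i → i ≤ -((n : ℤ) + 1) → η i = b)}

/-- The event that `η_i = b` for `−(n+l) ≤ i ≤ −n`. -/
def blockEvt (n l : ℕ) (b : Bool) : Set (ZSeq Bool) :=
  {η | ∀ i : ℤ, -((n : ℤ) + l) ≤ i → i ≤ -(n : ℤ) → η i = b}

/-- The event that `η_i = b` for `−n ≤ i ≤ −1`. -/
def allBlock (n : ℕ) (b : Bool) : Set (ZSeq Bool) :=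
  {η | ∀ i : ℤ, -(n : ℤ) ≤ i → i ≤ -1 → η i = b}

/-- `P` is the g-function `P^{+,b}` obtained from `ν` by conditioning on the symbol `b`
in the far past: `P(a|ω) = lim_n lim_l ν(η₀ = a | η = b on [−(n+l),−(n+1)], η = ω on [−n,−1])`,
both iterated limits being required to exist. -/
def IsCondG (ν : Measure (ZSeq Bool)) (b : Bool) (P : Bool → Past Bool → ℝ) : Prop :=
  ∀ (a : Bool) (ω : Past Bool), ∃ L : ℕ → ℝ,
    (∀ n, Tendsto (fun l => condProbR ν {η | η 0 = a} (pastEvt n l b ω)) atTop (𝓝 (L n))) ∧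
    Tendsto L atTop (𝓝 (P a ω))

/-- `ν'` is the iterated weak limit `lim_n lim_l ν( · | η = b on [−(n+l),−n])`. -/
def IsCondLimitMeasure (ν : Measure (ZSeq Bool)) (b : Bool) (ν' : Measure (ZSeq Bool)) : Prop :=
  ∃ νseq : ℕ → Measure (ZSeq Bool),
    (∀ n, CylTendsto (fun l => ν[|blockEvt n l b]) (νseq n)) ∧ CylTendsto νseq ν'

/-- Stochastic domination: `ν ≤ μ` iff `ν B ≤ μ B` for every increasing measurable event `B`. -/
def StochDom {A : Type*} [MeasurableSpace A] [Preorder A]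
    (ν μ : Measure (ZSeq A)) : Prop :=
  ∀ B : Set (ZSeq A), MeasurableSet B → (∀ ⦃x y : ZSeq A⦄, x ≤ y → x ∈ B → y ∈ B) → ν B ≤ μ B

/-- `π` is the i.i.d. product measure with `π(η_i = +1) = ρ` for each coordinate. -/
def IsBernoulliProd (ρ : ℝ) (π : Measure (ZSeq Bool)) : Prop :=
  IsProbabilityMeasure π ∧ ∀ (s : Finset ℤ) (f : ℤ → Bool),
    π {η | ∀ i ∈ s, η i = f i} = ∏ i ∈ s, ENNReal.ofReal (if f i then ρ else 1 - ρ)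

/-- Splicing of pasts: coordinates `−k,…,−1` (indices `< k`) from `ω`, the rest from `σ`. -/
def splice {A : Type*} (σ ω : Past A) (k : ℕ) : Past A := fun j => if j < k then ω j else σ j

/-- `ν'` is an extreme point of the convex set of g-measures consistent with `P`. -/
def ExtremeGMeasure (ν' : Measure (ZSeq Bool)) (P : Bool → Past Bool → ℝ) : Prop :=
  IsGMeasure ν' P ∧
  ∀ ν₁ ν₂ : Measure (ZSeq Bool), IsGMeasure ν₁ P → IsGMeasure ν₂ P →
    ∀ t : ℝ, t ∈ Set.Ioo (0 : ℝ) 1 →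
      ν' = ENNReal.ofReal t • ν₁ + ENNReal.ofReal (1 - t) • ν₂ → ν₁ = ν' ∧ ν₂ = ν'

/-- The event that the spins on the line are `−1` on `{−m,…,−n} × {0}`. -/
def lineMinusEvt (n m : ℕ) : Set Cfg2 :=
  {η | ∀ i : ℤ, -(m : ℤ) ≤ i → i ≤ -(n : ℤ) → η (i, 0) = false}

/-- Nearest-neighbour adjacency in `ℤ²` (`‖x−y‖₁ = 1`). -/
def adj2 (x y : ℤ × ℤ) : Prop := (x.1 - y.1).natAbs + (x.2 - y.2).natAbs = 1

/-- The event `A_n`: there is an infinite nearest-neighbour path of `+1` spins starting at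
`(n,0)` entirely contained in the half-plane `{x ≤ n}`. -/
def plusPathEvt (n : ℕ) : Set Cfg2 :=
  {η | ∃ γ : ℕ → ℤ × ℤ, γ 0 = ((n : ℤ), 0) ∧ (∀ j, adj2 (γ j) (γ (j + 1))) ∧
    Function.Injective γ ∧ (∀ j, (γ j).1 ≤ (n : ℤ)) ∧ ∀ j, η (γ j) = true}

/-- The block map for the decimation `ν_{l,k}`: the `j`-th letter consists of the spins on
`[j(k+l), j(k+l)+l−1]`. -/
def blockMap (l k : ℕ) (η : ZSeq Bool) : ZSeq (Fin l → Bool) :=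
  fun j r => η (j * ((k : ℤ) + l) + r)

end

/-! ## Pattern cylinders and the lattice condition -/

/-- An event prescribing the spins on a finite set of sites. -/
def IsPatternCylinder {ι : Type*} (A : Set (ι → Bool)) : Prop :=
  ∃ (S : Finset ι) (f : ι → Bool), A = {η | ∀ i ∈ S, η i = f i}

/-- The lattice (strong FKG) condition, formulated for pattern cylinders. -/
def LatticeCondition {ι : Type*} (μ : Measure (ι → Bool)) : Prop :=
  ∀ A B C D : Set (ι → Bool), IsPatternCylinder A → IsPatternCylinder B →
    IsPatternCylinder C → IsPatternCylinder D →
    (∀ a ∈ A, ∀ b ∈ B, a ⊓ b ∈ C ∧ a ⊔ b ∈ D) →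
    μ.real A * μ.real B ≤ μ.real C * μ.real D

open Classical in
/-- Flip the spin at `x`. -/
noncomputable def flipAt {ι : Type*} (x : ι) (η : ι → Bool) : ι → Bool :=
  Function.update η x (!η x)

/-- Flipping a single spin changes cylinder probabilities at most by the factor `c`. -/
def FiniteEnergy {ι : Type*} (μ : Measure (ι → Bool)) (c : ℝ) : Prop :=
  ∀ (x : ι) (A : Set (ι → Bool)), IsPatternCylinder A →
    c * μ.real A ≤ μ.real (flipAt x ⁻¹' A)

lemma flipAt_flipAt {ι : Type*} (x : ι) (η : ι → Bool) : flipAt x (flipAt x η) = η := by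
  simp [flipAt]

lemma flipAt_same {ι : Type*} (x : ι) (η : ι → Bool) : flipAt x η x = !η x := by
  simp [flipAt]

lemma flipAt_ne {ι : Type*} {x y : ι} (h : y ≠ x) (η : ι → Bool) : flipAt x η y = η y := by
  simp [flipAt, h]

lemma IsPatternCylinder.flip {ι : Type*} {A : Set (ι → Bool)} (hA : IsPatternCylinder A) (x : ι) :
    IsPatternCylinder (flipAt x ⁻¹' A) := by
  obtain ⟨S, f, rfl⟩ := hA
  refine ⟨S, flipAt x f, ?_⟩
  ext η
  simp only [Set.mem_preimage, Set.mem_ofPred_eq]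
  refine forall₂_congr fun i _ => ?_
  by_cases h : i = x
  · subst h
    rw [flipAt_same, flipAt_same]
    cases η i <;> cases f i <;> simp
  · rw [flipAt_ne h, flipAt_ne h]

lemma IsPatternCylinder.measurableSet {ι : Type*} {A : Set (ι → Bool)}
    (hA : IsPatternCylinder A) : MeasurableSet A := by
  obtain ⟨S, f, rfl⟩ := hA
  have : {η : ι → Bool | ∀ i ∈ S, η i = f i} = ⋂ i ∈ S, (fun η : ι → Bool => η i) ⁻¹' {f i} := by
    ext; simp
  rw [this]
  exact Finset.measurableSet_biInter _ fun i _ => measurable_pi_apply i (measurableSet_singleton _)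

/-! ## The Ising weights -/

/-- The exponent of `isingWeight` with plus boundary condition. -/
noncomputable def plusEnergy (β h : ℝ) (Λ : Finset (ℤ × ℤ)) (ω : Cfg2) : ℝ :=
  β * ((∑ x ∈ Λ, ∑ y ∈ Λ.filter (fun y => y ∈ nbrs x), sval (ω x) * sval (ω y)) / 2
      + ∑ x ∈ Λ, ∑ _y ∈ (nbrs x).filter (fun y => y ∉ Λ), sval (ω x))
    - h * ∑ x ∈ Λ, sval (ω x)

/-- The Ising weight with plus boundary condition. -/
noncomputable def plusWeight (β h : ℝ) (Λ : Finset (ℤ × ℤ)) (ω : Cfg2) : ℝ :=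
  isingWeight β h Λ (fun _ => true) ω

lemma plusWeight_eq (β h : ℝ) (Λ : Finset (ℤ × ℤ)) (ω : Cfg2) :
    plusWeight β h Λ ω = Real.exp (plusEnergy β h Λ ω) := by
  simp [plusWeight, isingWeight, plusEnergy, sval]

lemma plusWeight_pos (β h : ℝ) (Λ : Finset (ℤ × ℤ)) (ω : Cfg2) : 0 < plusWeight β h Λ ω :=
  Real.exp_pos _

lemma sval_inf_add_sup (a b : Bool) : sval (a ⊓ b) + sval (a ⊔ b) = sval a + sval b := by
  cases a <;> cases b <;> norm_num [sval]

lemma sval_mul_supermodular (a b c d : Bool) :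
    sval a * sval b + sval c * sval d ≤
      sval (a ⊓ c) * sval (b ⊓ d) + sval (a ⊔ c) * sval (b ⊔ d) := by
  cases a <;> cases b <;> cases c <;> cases d <;> norm_num [sval]

lemma plusWeight_mul_le {β : ℝ} (hβ : 0 < β) (h : ℝ) (Λ : Finset (ℤ × ℤ)) (a b : Cfg2) :
    plusWeight β h Λ a * plusWeight β h Λ b ≤
      plusWeight β h Λ (a ⊓ b) * plusWeight β h Λ (a ⊔ b) := by
  simp only [plusWeight_eq, ← Real.exp_add]
  apply Real.exp_le_exp.2
  have h1 : (∑ x ∈ Λ, ∑ y ∈ Λ.filter (fun y => y ∈ nbrs x), sval (a x) * sval (a y)) +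
      (∑ x ∈ Λ, ∑ y ∈ Λ.filter (fun y => y ∈ nbrs x), sval (b x) * sval (b y)) ≤
      (∑ x ∈ Λ, ∑ y ∈ Λ.filter (fun y => y ∈ nbrs x), sval ((a ⊓ b) x) * sval ((a ⊓ b) y)) +
      (∑ x ∈ Λ, ∑ y ∈ Λ.filter (fun y => y ∈ nbrs x), sval ((a ⊔ b) x) * sval ((a ⊔ b) y)) := by
    simp only [← Finset.sum_add_distrib]
    exact Finset.sum_le_sum fun x _ => Finset.sum_le_sum fun _ _ => sval_mul_supermodular _ _ _ _
  have h2 : (∑ x ∈ Λ, ∑ y ∈ (nbrs x).filter (fun y => y ∉ Λ), sval ((a ⊓ b) x)) +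
      (∑ x ∈ Λ, ∑ y ∈ (nbrs x).filter (fun y => y ∉ Λ), sval ((a ⊔ b) x)) =
      (∑ x ∈ Λ, ∑ y ∈ (nbrs x).filter (fun y => y ∉ Λ), sval (a x)) +
      (∑ x ∈ Λ, ∑ y ∈ (nbrs x).filter (fun y => y ∉ Λ), sval (b x)) := by
    simp only [← Finset.sum_add_distrib]
    exact Finset.sum_congr rfl fun x _ => Finset.sum_congr rfl fun y _ => sval_inf_add_sup _ _
  have h3 : (∑ x ∈ Λ, sval ((a ⊓ b) x)) + (∑ x ∈ Λ, sval ((a ⊔ b) x)) =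
      (∑ x ∈ Λ, sval (a x)) + (∑ x ∈ Λ, sval (b x)) := by
    simp only [← Finset.sum_add_distrib]
    exact Finset.sum_congr rfl fun x _ => sval_inf_add_sup _ _
  unfold plusEnergy
  have h1' := mul_le_mul_of_nonneg_left h1 hβ.le
  have h2' := congrArg (β * ·) h2
  have h3' := congrArg (h * ·) h3
  simp only [mul_add] at h1' h2' h3' ⊢
  linarith

lemma abs_sval (a : Bool) : |sval a| = 1 := by cases a <;> simp [sval]

lemma abs_sval_sub (a b : Bool) : |sval a - sval b| ≤ 2 := by
  cases a <;> cases b <;> norm_num [sval]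

lemma card_nbrs (x : ℤ × ℤ) : (nbrs x).card ≤ 4 := Finset.card_le_four

lemma mem_nbrs_comm {x y : ℤ × ℤ} : y ∈ nbrs x ↔ x ∈ nbrs y := by
  obtain ⟨a, b⟩ := x
  obtain ⟨c, d⟩ := y
  simp only [nbrs, Finset.mem_insert, Finset.mem_singleton, Prod.mk.injEq]
  omega

lemma abs_sval_flipAt_sub (z x : ℤ × ℤ) (ω : Cfg2) :
    |sval (flipAt z ω x) - sval (ω x)| ≤ if x = z then 2 else 0 := by
  split_ifs with h
  · exact abs_sval_sub _ _
  · rw [flipAt_ne h]; simp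

lemma abs_bond_flipAt_sub (z x y : ℤ × ℤ) (ω : Cfg2) :
    |sval (flipAt z ω x) * sval (flipAt z ω y) - sval (ω x) * sval (ω y)| ≤
      (if x = z then 2 else 0) + if y = z then 2 else 0 := by
  have e : sval (flipAt z ω x) * sval (flipAt z ω y) - sval (ω x) * sval (ω y) =
      (sval (flipAt z ω x) - sval (ω x)) * sval (flipAt z ω y) +
        sval (ω x) * (sval (flipAt z ω y) - sval (ω y)) := by ring
  rw [e]
  refine (abs_add_le _ _).trans ?_
  rw [abs_mul, abs_mul, abs_sval, abs_sval, mul_one, one_mul]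
  exact add_le_add (abs_sval_flipAt_sub _ _ _) (abs_sval_flipAt_sub _ _ _)

lemma abs_plusEnergy_flipAt_sub {β : ℝ} (hβ : 0 < β) (h : ℝ) (Λ : Finset (ℤ × ℤ)) (z : ℤ × ℤ)
    (ω : Cfg2) :
    |plusEnergy β h Λ (flipAt z ω) - plusEnergy β h Λ ω| ≤ 16 * β + 2 * |h| := by
  have single : ∀ F : ℤ × ℤ → Finset (ℤ × ℤ), (∀ x, F x ⊆ nbrs x) →
      ∑ x ∈ Λ, ∑ _y ∈ F x, (if x = z then (2 : ℝ) else 0) ≤ 8 := by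
    intro F hF
    have : ∀ x ∈ Λ, ∑ _y ∈ F x, (if x = z then (2 : ℝ) else 0) ≤ if x = z then 8 else 0 := by
      intro x _
      rw [Finset.sum_const, nsmul_eq_mul]
      have : ((F x).card : ℝ) ≤ 4 := by
        exact_mod_cast (Finset.card_le_card (hF x)).trans (card_nbrs x)
      split_ifs <;> linarith
    refine (Finset.sum_le_sum this).trans ?_
    rw [Finset.sum_ite_eq']
    split_ifs <;> norm_num
  have hsub : ∀ x, Λ.filter (fun y => y ∈ nbrs x) ⊆ nbrs x := fun x y hy =>
    (Finset.mem_filter.1 hy).2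
  have swap : ∑ x ∈ Λ, ∑ y ∈ Λ.filter (fun y => y ∈ nbrs x), (if y = z then (2 : ℝ) else 0) =
      ∑ x ∈ Λ, ∑ _y ∈ Λ.filter (fun y => y ∈ nbrs x), (if x = z then (2 : ℝ) else 0) := by
    simp only [Finset.sum_filter]
    rw [Finset.sum_comm]
    simp only [mem_nbrs_comm]
  have h1 : |(∑ x ∈ Λ, ∑ y ∈ Λ.filter (fun y => y ∈ nbrs x),
        sval (flipAt z ω x) * sval (flipAt z ω y)) -
      ∑ x ∈ Λ, ∑ y ∈ Λ.filter (fun y => y ∈ nbrs x), sval (ω x) * sval (ω y)| ≤ 16 := by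
    simp only [← Finset.sum_sub_distrib]
    refine (Finset.abs_sum_le_sum_abs _ _).trans <| (Finset.sum_le_sum fun x _ =>
      (Finset.abs_sum_le_sum_abs _ _).trans <| Finset.sum_le_sum fun y _ =>
        abs_bond_flipAt_sub z x y ω).trans ?_
    simp only [Finset.sum_add_distrib]
    rw [swap]
    linarith [single _ hsub]
  have h2 : |(∑ x ∈ Λ, ∑ y ∈ (nbrs x).filter (fun y => y ∉ Λ), sval (flipAt z ω x)) -
      ∑ x ∈ Λ, ∑ y ∈ (nbrs x).filter (fun y => y ∉ Λ), sval (ω x)| ≤ 8 := by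
    simp only [← Finset.sum_sub_distrib]
    exact (Finset.abs_sum_le_sum_abs _ _).trans <| (Finset.sum_le_sum fun x _ =>
      (Finset.abs_sum_le_sum_abs _ _).trans <| Finset.sum_le_sum fun y _ =>
        abs_sval_flipAt_sub z x ω).trans (single _ fun x => Finset.filter_subset _ _)
  have h3 : |(∑ x ∈ Λ, sval (flipAt z ω x)) - ∑ x ∈ Λ, sval (ω x)| ≤ 2 := by
    simp only [← Finset.sum_sub_distrib]
    refine (Finset.abs_sum_le_sum_abs _ _).trans <| (Finset.sum_le_sum fun x _ =>
      abs_sval_flipAt_sub z x ω).trans ?_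
    rw [Finset.sum_ite_eq']
    split_ifs <;> norm_num
  unfold plusEnergy
  set I := ∑ x ∈ Λ, ∑ y ∈ Λ.filter (fun y => y ∈ nbrs x), sval (ω x) * sval (ω y)
  set I' := ∑ x ∈ Λ, ∑ y ∈ Λ.filter (fun y => y ∈ nbrs x),
    sval (flipAt z ω x) * sval (flipAt z ω y)
  set B := ∑ x ∈ Λ, ∑ y ∈ (nbrs x).filter (fun y => y ∉ Λ), sval (ω x)
  set B' := ∑ x ∈ Λ, ∑ y ∈ (nbrs x).filter (fun y => y ∉ Λ), sval (flipAt z ω x)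
  set M := ∑ x ∈ Λ, sval (ω x)
  set M' := ∑ x ∈ Λ, sval (flipAt z ω x)
  have e : β * (I' / 2 + B') - h * M' - (β * (I / 2 + B) - h * M) =
      β * ((I' - I) / 2 + (B' - B)) - h * (M' - M) := by ring
  rw [e]
  refine (abs_sub _ _).trans ?_
  rw [abs_mul, abs_mul, abs_of_pos hβ]
  have h4 : |(I' - I) / 2 + (B' - B)| ≤ 16 := by
    rw [abs_le] at h1 h2 ⊢
    constructor <;> linarith
  have := mul_le_mul_of_nonneg_left h4 hβ.le
  have := mul_le_mul_of_nonneg_left h3 (abs_nonneg h)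
  linarith

/-- The constant in the finite energy property. -/
noncomputable def energyConst (β h : ℝ) : ℝ := Real.exp (-(16 * β + 2 * |h|))

lemma energyConst_mul_plusWeight_le {β : ℝ} (hβ : 0 < β) (h : ℝ) (Λ : Finset (ℤ × ℤ))
    (z : ℤ × ℤ) (ω : Cfg2) :
    energyConst β h * plusWeight β h Λ ω ≤ plusWeight β h Λ (flipAt z ω) := by
  rw [plusWeight_eq, plusWeight_eq, energyConst, ← Real.exp_add]
  apply Real.exp_le_exp.2
  have := (abs_le.1 (abs_plusEnergy_flipAt_sub hβ h Λ z ω)).1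
  linarith

/-- Configurations equal to `+1` outside `Λ`. -/
def IsPlusOff (Λ : Finset (ℤ × ℤ)) (ω : Cfg2) : Prop := ∀ x ∉ Λ, ω x = true

lemma plusEnergy_sub_eq (β h : ℝ) {Λ Λ' : Finset (ℤ × ℤ)} (hΛ : Λ ⊆ Λ') {ω ω' : Cfg2}
    (hω : IsPlusOff Λ ω) (hω' : IsPlusOff Λ ω') :
    plusEnergy β h Λ' ω - plusEnergy β h Λ ω = plusEnergy β h Λ' ω' - plusEnergy β h Λ ω' := by
  have key : ∀ ω : Cfg2, IsPlusOff Λ ω → plusEnergy β h Λ' ω - plusEnergy β h Λ ω =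
      β * ((∑ x ∈ Λ' \ Λ, ∑ y ∈ (Λ' \ Λ).filter (fun y => y ∈ nbrs x), (1 : ℝ)) / 2 +
        ∑ x ∈ Λ' \ Λ, ∑ y ∈ (nbrs x).filter (fun y => y ∉ Λ'), (1 : ℝ)) -
        h * ∑ x ∈ Λ' \ Λ, (1 : ℝ) := by
    intro ω hω
    have one : ∀ x ∈ Λ' \ Λ, sval (ω x) = 1 := fun x hx => by
      simp [sval, hω x (Finset.mem_sdiff.1 hx).2]
    have split : ∀ g : ℤ × ℤ → ℝ, ∑ x ∈ Λ', g x = ∑ x ∈ Λ, g x + ∑ x ∈ Λ' \ Λ, g x := fun g => by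
      rw [add_comm, Finset.sum_sdiff hΛ]
    have hI : ∑ x ∈ Λ', ∑ y ∈ Λ'.filter (fun y => y ∈ nbrs x), sval (ω x) * sval (ω y) =
        ∑ x ∈ Λ, ∑ y ∈ Λ.filter (fun y => y ∈ nbrs x), sval (ω x) * sval (ω y) +
        2 * (∑ x ∈ Λ, ∑ y ∈ (Λ' \ Λ).filter (fun y => y ∈ nbrs x), sval (ω x)) +
        ∑ x ∈ Λ' \ Λ, ∑ y ∈ (Λ' \ Λ).filter (fun y => y ∈ nbrs x), (1 : ℝ) := by
      simp only [Finset.sum_filter]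
      rw [split]
      simp only [split, Finset.sum_add_distrib]
      have e1 : ∑ x ∈ Λ, ∑ y ∈ Λ' \ Λ, (if y ∈ nbrs x then sval (ω x) * sval (ω y) else 0) =
          ∑ x ∈ Λ, ∑ y ∈ Λ' \ Λ, (if y ∈ nbrs x then sval (ω x) else 0) :=
        Finset.sum_congr rfl fun x _ => Finset.sum_congr rfl fun y hy => by rw [one y hy, mul_one]
      have e2 : ∑ x ∈ Λ' \ Λ, ∑ y ∈ Λ, (if y ∈ nbrs x then sval (ω x) * sval (ω y) else 0) =
          ∑ x ∈ Λ, ∑ y ∈ Λ' \ Λ, (if y ∈ nbrs x then sval (ω x) else 0) := by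
        rw [Finset.sum_comm]
        refine Finset.sum_congr rfl fun x _ => Finset.sum_congr rfl fun y hy => ?_
        rw [one y hy, one_mul]
        simp only [mem_nbrs_comm (x := x)]
      have e3 : ∑ x ∈ Λ' \ Λ, ∑ y ∈ Λ' \ Λ,
          (if y ∈ nbrs x then sval (ω x) * sval (ω y) else 0) =
          ∑ x ∈ Λ' \ Λ, ∑ y ∈ Λ' \ Λ, (if y ∈ nbrs x then (1 : ℝ) else 0) :=
        Finset.sum_congr rfl fun x hx => Finset.sum_congr rfl fun y hy => by
          rw [one y hy, one x hx, mul_one]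
      rw [e1, e2, e3]
      ring
    have hB : ∑ x ∈ Λ, ∑ y ∈ (nbrs x).filter (fun y => y ∉ Λ), sval (ω x) =
        ∑ x ∈ Λ, ∑ y ∈ (Λ' \ Λ).filter (fun y => y ∈ nbrs x), sval (ω x) +
        ∑ x ∈ Λ, ∑ y ∈ (nbrs x).filter (fun y => y ∉ Λ'), sval (ω x) := by
      rw [← Finset.sum_add_distrib]
      refine Finset.sum_congr rfl fun x _ => ?_
      rw [← Finset.sum_union]
      · refine Finset.sum_congr ?_ fun _ _ => rfl
        ext y
        have := @hΛ y
        simp only [Finset.mem_filter, Finset.mem_union, Finset.mem_sdiff]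
        tauto
      · rw [Finset.disjoint_left]
        intro y hy hy'
        simp only [Finset.mem_filter, Finset.mem_sdiff] at hy hy'
        tauto
    have hB' : ∑ x ∈ Λ', ∑ y ∈ (nbrs x).filter (fun y => y ∉ Λ'), sval (ω x) =
        ∑ x ∈ Λ, ∑ y ∈ (nbrs x).filter (fun y => y ∉ Λ'), sval (ω x) +
        ∑ x ∈ Λ' \ Λ, ∑ y ∈ (nbrs x).filter (fun y => y ∉ Λ'), (1 : ℝ) := by
      rw [split]
      congr 1
      exact Finset.sum_congr rfl fun x hx => Finset.sum_congr rfl fun y _ => one x hx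
    have hM : ∑ x ∈ Λ', sval (ω x) = ∑ x ∈ Λ, sval (ω x) + ∑ x ∈ Λ' \ Λ, (1 : ℝ) := by
      rw [split]
      congr 1
      exact Finset.sum_congr rfl one
    unfold plusEnergy
    rw [hI, hB, hB', hM]
    ring
  rw [key ω hω, key ω' hω']

/-! ## Finite-volume measures -/

open Classical in
/-- The finite set of configurations equal to `+1` outside `Λ`. -/
noncomputable def plusConfigs (Λ : Finset (ℤ × ℤ)) : Finset Cfg2 :=
  Finset.univ.image (fill Λ fun _ => true)

lemma mem_plusConfigs {Λ : Finset (ℤ × ℤ)} {ω : Cfg2} : ω ∈ plusConfigs Λ ↔ IsPlusOff Λ ω := by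
  simp only [plusConfigs, Finset.mem_image, Finset.mem_univ, true_and]
  constructor
  · rintro ⟨τ, rfl⟩ x hx
    simp [fill, hx]
  · intro hω
    refine ⟨fun x => ω x, funext fun x => ?_⟩
    by_cases hx : x ∈ Λ
    · simp [fill, hx]
    · simp [fill, hx, hω x hx]

lemma fill_injective (Λ : Finset (ℤ × ℤ)) (σ : Cfg2) : Function.Injective (fill Λ σ) := by
  intro τ τ' h
  funext x
  have := congrFun h x
  simpa [fill] using this

open Classical in
/-- The total weight of an event among the configurations equal to `+1` outside `Λ`. -/
noncomputable def plusSum (β h : ℝ) (Λ : Finset (ℤ × ℤ)) (A : Set Cfg2) : ℝ :=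
  ∑ ω ∈ (plusConfigs Λ).filter (· ∈ A), plusWeight β h Λ ω

lemma plusSum_nonneg (β h : ℝ) (Λ : Finset (ℤ × ℤ)) (A : Set Cfg2) : 0 ≤ plusSum β h Λ A :=
  Finset.sum_nonneg fun _ _ => (plusWeight_pos _ _ _ _).le

lemma plusSum_univ_pos (β h : ℝ) (Λ : Finset (ℤ × ℤ)) : 0 < plusSum β h Λ Set.univ := by
  refine Finset.sum_pos (fun _ _ => plusWeight_pos _ _ _ _) ⟨fun _ => true, ?_⟩
  simp [mem_plusConfigs, IsPlusOff]

/-- The finite-volume Ising measure with plus boundary condition. -/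
noncomputable abbrev plusFV (β h : ℝ) (Λ : Finset (ℤ × ℤ)) : Measure Cfg2 :=
  isingFV β h Λ fun _ => true

lemma plusFV_real (β h : ℝ) (Λ : Finset (ℤ × ℤ)) {A : Set Cfg2} (hA : MeasurableSet A) :
    (plusFV β h Λ).real A = plusSum β h Λ A / plusSum β h Λ Set.univ := by
  classical
  have key : ∀ B : Set Cfg2, plusSum β h Λ B = ∑ τ : ↥Λ → Bool,
      plusWeight β h Λ (fill Λ (fun _ => true) τ) *
        B.indicator 1 (fill Λ (fun _ => true) τ) := by
    intro B
    rw [plusSum, Finset.sum_filter, plusConfigs,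
      Finset.sum_image fun _ _ _ _ e => fill_injective Λ _ e]
    exact Finset.sum_congr rfl fun τ _ => by simp [Set.indicator_apply]
  have hw : ∀ τ, (ENNReal.ofReal (isingWeight β h Λ (fun _ => true)
      (fill Λ (fun _ => true) τ))).toReal = plusWeight β h Λ (fill Λ (fun _ => true) τ) :=
    fun τ => ENNReal.toReal_ofReal (plusWeight_pos β h Λ _).le
  rw [Measure.real, plusFV, isingFV, key, key]
  simp only [Measure.smul_apply, Measure.finsetSum_apply, smul_eq_mul, ENNReal.toReal_mul,
    ENNReal.toReal_inv]
  rw [ENNReal.toReal_sum fun _ _ => ENNReal.ofReal_ne_top, ENNReal.toReal_sum, div_eq_inv_mul]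
  · congr 1
    · congr 1
      refine Finset.sum_congr rfl fun τ _ => ?_
      simp [hw]
    · refine Finset.sum_congr rfl fun τ _ => ?_
      rw [ENNReal.toReal_mul, hw, Measure.dirac_apply' _ hA]
      congr 1
      by_cases hτ : fill Λ (fun _ => true) τ ∈ A <;> simp [hτ]
  · intro τ _
    refine ENNReal.mul_ne_top ENNReal.ofReal_ne_top ?_
    rw [Measure.dirac_apply' _ hA]
    by_cases hτ : fill Λ (fun _ => true) τ ∈ A <;> simp [hτ]

lemma plusSum_mul_le {β : ℝ} (hβ : 0 < β) (h : ℝ) (Λ : Finset (ℤ × ℤ)) {A B C D : Set Cfg2}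
    (H : ∀ a ∈ A, IsPlusOff Λ a → ∀ b ∈ B, IsPlusOff Λ b → a ⊓ b ∈ C ∧ a ⊔ b ∈ D) :
    plusSum β h Λ A * plusSum β h Λ B ≤ plusSum β h Λ C * plusSum β h Λ D := by
  classical
  have h0 : 0 ≤ plusWeight β h Λ := fun ω => (plusWeight_pos β h Λ ω).le
  refine (four_functions_theorem _ _ _ _ h0 h0 h0 h0 (plusWeight_mul_le hβ h Λ) _ _).trans ?_
  refine mul_le_mul ?_ ?_ (Finset.sum_nonneg fun _ _ => h0 _) (plusSum_nonneg _ _ _ _) <;>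
  · refine Finset.sum_le_sum_of_subset_of_nonneg ?_ fun _ _ _ => h0 _
    intro ω hω
    simp only [Finset.mem_infs, Finset.mem_sups, Finset.mem_filter, mem_plusConfigs] at hω ⊢
    obtain ⟨a, ⟨ha, haA⟩, b, ⟨hb, hbB⟩, rfl⟩ := hω
    refine ⟨fun x hx => by simp [ha x hx, hb x hx], ?_⟩
    have := H a haA ha b hbB hb
    first | exact this.1 | exact this.2

lemma plusFV_isProbabilityMeasure (β h : ℝ) (Λ : Finset (ℤ × ℤ)) :
    IsProbabilityMeasure (plusFV β h Λ) := by
  have := plusFV_real β h Λ MeasurableSet.univ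
  rw [div_self (plusSum_univ_pos β h Λ).ne'] at this
  refine ⟨?_⟩
  rw [Measure.real, ENNReal.toReal_eq_one_iff] at this
  exact this

lemma plusFV_mul_le {β : ℝ} (hβ : 0 < β) (h : ℝ) (Λ : Finset (ℤ × ℤ)) {A B C D : Set Cfg2}
    (hA : MeasurableSet A) (hB : MeasurableSet B) (hC : MeasurableSet C) (hD : MeasurableSet D)
    (H : ∀ a ∈ A, ∀ b ∈ B, a ⊓ b ∈ C ∧ a ⊔ b ∈ D) :
    (plusFV β h Λ).real A * (plusFV β h Λ).real B ≤
      (plusFV β h Λ).real C * (plusFV β h Λ).real D := by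
  have := plusSum_univ_pos β h Λ
  rw [plusFV_real _ _ _ hA, plusFV_real _ _ _ hB, plusFV_real _ _ _ hC, plusFV_real _ _ _ hD,
    div_mul_div_comm, div_mul_div_comm]
  exact div_le_div_of_nonneg_right
    (plusSum_mul_le hβ h Λ fun a ha _ b hb _ => H a ha b hb) (by positivity)

lemma plusFV_flip {β : ℝ} (hβ : 0 < β) (h : ℝ) {Λ : Finset (ℤ × ℤ)} {z : ℤ × ℤ} (hz : z ∈ Λ)
    {A : Set Cfg2} (hA : MeasurableSet A) (hA' : MeasurableSet (flipAt z ⁻¹' A)) :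
    energyConst β h * (plusFV β h Λ).real A ≤ (plusFV β h Λ).real (flipAt z ⁻¹' A) := by
  classical
  rw [plusFV_real _ _ _ hA, plusFV_real _ _ _ hA', ← mul_div_assoc]
  have := plusSum_univ_pos β h Λ
  gcongr
  rw [plusSum, plusSum, Finset.mul_sum]
  refine (Finset.sum_le_sum fun ω _ => energyConst_mul_plusWeight_le hβ h Λ z ω).trans_eq ?_
  have hflip : ∀ ω, IsPlusOff Λ ω → IsPlusOff Λ (flipAt z ω) := by
    intro ω hω x hx
    rw [flipAt_ne (by rintro rfl; exact hx hz), hω x hx]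
  refine Finset.sum_nbij' (flipAt z) (flipAt z) ?_ ?_ ?_ ?_ ?_
  · intro ω hω
    simp only [Finset.mem_filter, mem_plusConfigs, Set.mem_preimage, flipAt_flipAt] at hω ⊢
    exact ⟨hflip _ hω.1, hω.2⟩
  · intro ω hω
    simp only [Finset.mem_filter, mem_plusConfigs, Set.mem_preimage] at hω ⊢
    exact ⟨hflip _ hω.1, hω.2⟩
  · exact fun _ _ => flipAt_flipAt _ _
  · exact fun _ _ => flipAt_flipAt _ _
  · exact fun _ _ => rfl

/-- Spatial Markov property for the plus boundary condition. -/
lemma exists_plusSum_inter_eq (β h : ℝ) {Λ Λ' : Finset (ℤ × ℤ)} (hΛ : Λ ⊆ Λ') :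
    ∃ c > 0, ∀ A : Set Cfg2,
      plusSum β h Λ' (A ∩ {ω | IsPlusOff Λ ω}) = c * plusSum β h Λ A := by
  classical
  have h1 : IsPlusOff Λ fun _ => true := fun _ _ => rfl
  refine ⟨Real.exp (plusEnergy β h Λ' (fun _ => true) - plusEnergy β h Λ fun _ => true),
    Real.exp_pos _, fun A => ?_⟩
  rw [plusSum, plusSum, Finset.mul_sum]
  refine Finset.sum_congr ?_ fun ω hω => ?_
  · ext ω
    simp only [Finset.mem_filter, mem_plusConfigs, Set.mem_inter_iff, Set.mem_ofPred_eq]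
    exact ⟨fun H => ⟨H.2.2, H.2.1⟩, fun H => ⟨fun x hx => H.1 x fun hx' => hx (hΛ hx'), H.2, H.1⟩⟩
  have hω : IsPlusOff Λ ω := mem_plusConfigs.1 (Finset.mem_filter.1 hω).1
  rw [plusWeight_eq, plusWeight_eq, ← Real.exp_add]
  congr 1
  linarith [plusEnergy_sub_eq β h hΛ hω h1]

/-- In a larger volume, conditioning on plus spins outside `Λ` gives a measure dominated by the
finite-volume measure in `Λ`. -/
lemma plusFV_inter_le {β : ℝ} (hβ : 0 < β) (h : ℝ) {Λ Λ' : Finset (ℤ × ℤ)} (hΛ : Λ ⊆ Λ')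
    {T : Set (ℤ × ℤ)} (hT : ∀ x ∈ T, x ∉ Λ) {A V : Set Cfg2} (hA : MeasurableSet A)
    (hV : V = {ω | ∀ x ∈ T, ω x = true}) (hVm : MeasurableSet V) (hAup : IsUpperSet A) :
    (plusFV β h Λ').real (A ∩ V) ≤ (plusFV β h Λ').real V * (plusFV β h Λ).real A := by
  obtain ⟨c, hc, H⟩ := exists_plusSum_inter_eq β h hΛ
  have key := plusSum_mul_le (A := A ∩ V) (B := Set.univ ∩ {ω | IsPlusOff Λ ω}) (C := V)
    (D := A ∩ {ω | IsPlusOff Λ ω}) hβ h Λ' (by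
      rintro a ⟨haA, haV⟩ - b ⟨-, hb⟩ -
      rw [hV] at haV ⊢
      refine ⟨fun x hx => ?_, hAup le_sup_left haA, fun x hx => ?_⟩
      · simp [haV x hx, hb x (hT x hx)]
      · simp [hb x hx])
  rw [H, H] at key
  rw [plusFV_real _ _ _ (hA.inter hVm), plusFV_real _ _ _ hVm, plusFV_real _ _ _ hA]
  have p := plusSum_univ_pos β h Λ
  have p' := plusSum_univ_pos β h Λ'
  rw [div_mul_div_comm, div_le_div_iff₀ p' (mul_pos p' p)]
  have key' : plusSum β h Λ' (A ∩ V) * plusSum β h Λ Set.univ ≤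
      plusSum β h Λ' V * plusSum β h Λ A := by
    refine le_of_mul_le_mul_left ?_ hc
    linarith
  nlinarith

lemma plusFV_antitone {β : ℝ} (hβ : 0 < β) (h : ℝ) {Λ Λ' : Finset (ℤ × ℤ)} (hΛ : Λ ⊆ Λ')
    {A : Set Cfg2} (hA : MeasurableSet A) (hAup : IsUpperSet A) :
    (plusFV β h Λ').real A ≤ (plusFV β h Λ).real A := by
  have := plusFV_isProbabilityMeasure β h Λ'
  simpa using plusFV_inter_le hβ h hΛ (T := ∅) (V := Set.univ) (by simp) hA (by simp)
    MeasurableSet.univ hAup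

/-! ### Translations -/

/-- The translation of configurations by `v`. -/
def translateBy (v : ℤ × ℤ) (ω : Cfg2) : Cfg2 := fun x => ω (x + v)

lemma mem_nbrs_add {x y v : ℤ × ℤ} : y + v ∈ nbrs (x + v) ↔ y ∈ nbrs x := by
  obtain ⟨a, b⟩ := x
  obtain ⟨c, d⟩ := y
  obtain ⟨p, q⟩ := v
  simp only [nbrs, Prod.mk_add_mk, Finset.mem_insert, Finset.mem_singleton, Prod.mk.injEq]
  omega

lemma nbrs_add (x v : ℤ × ℤ) : nbrs (x + v) = (nbrs x).map (Equiv.addRight v).toEmbedding := by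
  ext y
  rw [Finset.mem_map_equiv, ← mem_nbrs_add (x := x) (v := v)]
  simp

lemma mem_map_addRight {Λ : Finset (ℤ × ℤ)} {x v : ℤ × ℤ} :
    x + v ∈ Λ.map (Equiv.addRight v).toEmbedding ↔ x ∈ Λ := by
  rw [Finset.mem_map_equiv]
  simp

lemma plusEnergy_translate (β h : ℝ) (Λ : Finset (ℤ × ℤ)) (v : ℤ × ℤ) (ω : Cfg2) :
    plusEnergy β h (Λ.map (Equiv.addRight v).toEmbedding) ω =
      plusEnergy β h Λ (translateBy v ω) := by
  simp only [plusEnergy, Finset.sum_filter, Finset.sum_map, Equiv.coe_toEmbedding,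
    Equiv.coe_addRight, nbrs_add, mem_map_addRight, translateBy]

lemma plusSum_translate (β h : ℝ) (Λ : Finset (ℤ × ℤ)) (v : ℤ × ℤ) (A : Set Cfg2) :
    plusSum β h (Λ.map (Equiv.addRight v).toEmbedding) (translateBy v ⁻¹' A) =
      plusSum β h Λ A := by
  classical
  rw [plusSum, plusSum]
  have h1 : ∀ w ω, translateBy w (translateBy (-w) ω) = ω := fun w ω => by
    funext x; simp [translateBy]
  have h2 : ∀ w ω, translateBy (-w) (translateBy w ω) = ω := fun w ω => by
    funext x; simp [translateBy]
  have hp : ∀ ω, IsPlusOff (Λ.map (Equiv.addRight v).toEmbedding) ω ↔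
      IsPlusOff Λ (translateBy v ω) := fun ω => by
    constructor
    · intro H x hx
      exact H _ (by rwa [mem_map_addRight])
    · intro H x hx
      have := H (x - v) (by rwa [← mem_map_addRight (v := v), sub_add_cancel])
      simpa [translateBy] using this
  refine Finset.sum_nbij' (translateBy v) (translateBy (-v)) ?_ ?_ ?_ ?_ ?_
  · intro ω hω
    simpa only [Finset.mem_filter, mem_plusConfigs, Set.mem_preimage, hp] using hω
  · intro ω hω
    simpa only [Finset.mem_filter, mem_plusConfigs, Set.mem_preimage, hp, h1] using hω
  · exact fun _ _ => h2 _ _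
  · exact fun _ _ => h1 _ _
  · intro ω _
    rw [plusWeight_eq, plusWeight_eq, plusEnergy_translate]

lemma plusFV_translate (β h : ℝ) (Λ : Finset (ℤ × ℤ)) (v : ℤ × ℤ) {A : Set Cfg2}
    (hA : MeasurableSet A) :
    (plusFV β h (Λ.map (Equiv.addRight v).toEmbedding)).real (translateBy v ⁻¹' A) =
      (plusFV β h Λ).real A := by
  have hm : Measurable (translateBy v) := measurable_pi_lambda _ fun x => measurable_pi_apply _
  rw [plusFV_real _ _ _ (hm hA), plusFV_real _ _ _ hA, plusSum_translate]
  congr 1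
  rw [← plusSum_translate β h Λ v, Set.preimage_univ]

/-! ## The plus phase and its Schonmann projection -/

lemma isPatternCylinder_true {ι : Type*} (S : Finset ι) :
    IsPatternCylinder {η : ι → Bool | ∀ i ∈ S, η i = true} := ⟨S, fun _ => true, rfl⟩

lemma isUpperSet_true {ι : Type*} (S : Set ι) :
    IsUpperSet {η : ι → Bool | ∀ i ∈ S, η i = true} := by
  intro a b hab ha i hi
  have := hab i
  rw [ha i hi] at this
  exact top_unique this

lemma IsPlusPhase.tendsto {β h : ℝ} {μ : Measure Cfg2} (hμ : IsPlusPhase β h μ) {A : Set Cfg2}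
    (hA : IsPatternCylinder A) :
    Tendsto (fun n => (plusFV β h (box n)).real A) atTop (𝓝 (μ.real A)) := by
  have := hμ.1
  obtain ⟨S, f, rfl⟩ := hA
  exact (ENNReal.tendsto_toReal (measure_ne_top _ _)).comp (hμ.2 S f)

lemma IsPlusPhase.latticeCondition {β h : ℝ} (hβ : 0 < β) {μ : Measure Cfg2}
    (hμ : IsPlusPhase β h μ) : LatticeCondition μ := by
  intro A B C D hA hB hC hD H
  exact le_of_tendsto_of_tendsto' ((hμ.tendsto hA).mul (hμ.tendsto hB))
    ((hμ.tendsto hC).mul (hμ.tendsto hD)) fun n =>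
      plusFV_mul_le hβ h _ hA.measurableSet hB.measurableSet hC.measurableSet hD.measurableSet H

lemma eventually_mem_box (z : ℤ × ℤ) : ∀ᶠ n in atTop, z ∈ box n := by
  filter_upwards [eventually_ge_atTop (max z.1.natAbs z.2.natAbs)] with n hn
  simp only [box, Finset.mem_product, Finset.mem_Icc]
  omega

lemma IsPlusPhase.finiteEnergy {β h : ℝ} (hβ : 0 < β) {μ : Measure Cfg2}
    (hμ : IsPlusPhase β h μ) : FiniteEnergy μ (energyConst β h) := by
  intro z A hA
  refine le_of_tendsto_of_tendsto ((hμ.tendsto hA).const_mul _) (hμ.tendsto (hA.flip z)) ?_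
  filter_upwards [eventually_mem_box z] with n hn
  exact plusFV_flip hβ h hn hA.measurableSet (hA.flip z).measurableSet

lemma box_mono {m n : ℕ} (hmn : m ≤ n) : box m ⊆ box n := by
  intro z
  simp only [box, Finset.mem_product, Finset.mem_Icc]
  omega

lemma IsPlusPhase.inter_le {β h : ℝ} (hβ : 0 < β) {μ : Measure Cfg2}
    (hμ : IsPlusPhase β h μ) (n : ℕ) {S T : Finset (ℤ × ℤ)} (hT : ∀ x ∈ T, x ∉ box n) :
    μ.real ({ω | ∀ x ∈ S, ω x = true} ∩ {ω | ∀ x ∈ T, ω x = true}) ≤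
      μ.real {ω | ∀ x ∈ T, ω x = true} *
        (plusFV β h (box n)).real {ω | ∀ x ∈ S, ω x = true} := by
  have hST : IsPatternCylinder
      ({ω : Cfg2 | ∀ x ∈ S, ω x = true} ∩ {ω | ∀ x ∈ T, ω x = true}) := by
    classical
    refine ⟨S ∪ T, fun _ => true, ?_⟩
    ext ω
    simp only [Set.mem_inter_iff, Set.mem_ofPred_eq, Finset.mem_union, or_imp, forall_and]
  refine le_of_tendsto_of_tendsto (hμ.tendsto hST)
    ((hμ.tendsto (isPatternCylinder_true T)).mul_const _) ?_
  filter_upwards [eventually_ge_atTop n] with m hm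
  exact plusFV_inter_le hβ h (box_mono hm) (T := (T : Set (ℤ × ℤ))) hT
    (isPatternCylinder_true S).measurableSet rfl (isPatternCylinder_true T).measurableSet
    (isUpperSet_true _)

lemma IsPlusPhase.translate_le {β h : ℝ} (hβ : 0 < β) {μ : Measure Cfg2}
    (hμ : IsPlusPhase β h μ) {v : ℤ × ℤ} (hv : v ∈ box 1) (S : Finset (ℤ × ℤ)) :
    μ.real {ω | ∀ x ∈ S, ω (x + v) = true} ≤ μ.real {ω | ∀ x ∈ S, ω x = true} := by
  have e : {ω : Cfg2 | ∀ x ∈ S, ω (x + v) = true} =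
      {ω | ∀ x ∈ S.map (Equiv.addRight v).toEmbedding, ω x = true} := by
    ext ω
    simp only [Set.mem_ofPred_eq, Finset.forall_mem_map]
    rfl
  have hcyl := isPatternCylinder_true (S.map (Equiv.addRight v).toEmbedding)
  rw [e]
  refine le_of_tendsto_of_tendsto' ((tendsto_add_atTop_iff_nat 1).2 (hμ.tendsto hcyl))
    (hμ.tendsto (isPatternCylinder_true S)) fun n => ?_
  rw [← plusFV_translate β h (box n) v (isPatternCylinder_true S).measurableSet]
  have e' : translateBy v ⁻¹' {ω : Cfg2 | ∀ x ∈ S, ω x = true} =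
      {ω | ∀ x ∈ S.map (Equiv.addRight v).toEmbedding, ω x = true} := e
  rw [e']
  refine plusFV_antitone hβ h ?_ hcyl.measurableSet (isUpperSet_true _)
  intro x hx
  rw [Finset.mem_map_equiv] at hx
  obtain ⟨a, b⟩ := x
  obtain ⟨p, q⟩ := v
  simp only [box, Finset.mem_product, Finset.mem_Icc, Equiv.addRight_symm, Equiv.coe_addRight,
    Prod.neg_mk, Prod.mk_add_mk, Nat.cast_one, Nat.cast_add] at hx hv ⊢
  omega

lemma IsPlusPhase.translate_eq {β h : ℝ} (hβ : 0 < β) {μ : Measure Cfg2}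
    (hμ : IsPlusPhase β h μ) {v : ℤ × ℤ} (hv : v ∈ box 1) (S : Finset (ℤ × ℤ)) :
    μ.real {ω | ∀ x ∈ S, ω (x + v) = true} = μ.real {ω | ∀ x ∈ S, ω x = true} := by
  refine le_antisymm (hμ.translate_le hβ hv S) ?_
  have hv' : -v ∈ box 1 := by
    obtain ⟨p, q⟩ := v
    simp only [box, Finset.mem_product, Finset.mem_Icc, Prod.neg_mk] at hv ⊢
    omega
  simpa only [Finset.forall_mem_map, Equiv.coe_toEmbedding, Equiv.coe_addRight,
    add_neg_cancel_right] using hμ.translate_le hβ hv' (S.map (Equiv.addRight v).toEmbedding)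

lemma measurable_lineProj : Measurable lineProj :=
  measurable_pi_lambda _ fun _ => measurable_pi_apply _

lemma measurable_shiftSeq {A : Type*} [MeasurableSpace A] : Measurable (shiftSeq (A := A)) :=
  measurable_pi_lambda _ fun _ => measurable_pi_apply _

lemma measurable_restrictPast {A : Type*} [MeasurableSpace A] :
    Measurable (restrictPast (A := A)) :=
  measurable_pi_lambda _ fun _ => measurable_pi_apply _

lemma schonmann_real (μ : Measure Cfg2) {A : Set (ZSeq Bool)} (hA : MeasurableSet A) :
    (schonmann μ).real A = μ.real (lineProj ⁻¹' A) :=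
  map_measureReal_apply measurable_lineProj hA

lemma IsPatternCylinder.lineProj {A : Set (ZSeq Bool)} (hA : IsPatternCylinder A) :
    IsPatternCylinder (lineProj ⁻¹' A) := by
  classical
  obtain ⟨S, f, rfl⟩ := hA
  refine ⟨S.image fun i => (i, 0), fun x => f x.1, ?_⟩
  ext ω
  simp [_root_.lineProj]

lemma LatticeCondition.schonmann {μ : Measure Cfg2} (hμ : LatticeCondition μ) :
    LatticeCondition (schonmann μ) := by
  intro A B C D hA hB hC hD H
  rw [schonmann_real _ hA.measurableSet, schonmann_real _ hB.measurableSet,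
    schonmann_real _ hC.measurableSet, schonmann_real _ hD.measurableSet]
  exact hμ _ _ _ _ hA.lineProj hB.lineProj hC.lineProj hD.lineProj fun a ha b hb =>
    H _ ha _ hb

lemma FiniteEnergy.schonmann {μ : Measure Cfg2} {c : ℝ} (hμ : FiniteEnergy μ c) :
    FiniteEnergy (schonmann μ) c := by
  intro x A hA
  rw [schonmann_real _ hA.measurableSet, schonmann_real _ (hA.flip x).measurableSet]
  convert hμ (x, 0) _ hA.lineProj using 2
  rw [← Set.preimage_comp, ← Set.preimage_comp]
  congr 1
  funext ω i
  simp only [Function.comp, lineProj]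
  by_cases h : i = x
  · subst h
    rw [flipAt_same, flipAt_same, lineProj]
  · rw [flipAt_ne h, flipAt_ne (by simpa using h), lineProj]

lemma pi_eq_generateFrom_true (ι : Type*) : (MeasurableSpace.pi : MeasurableSpace (ι → Bool)) =
    MeasurableSpace.generateFrom
      (Set.range fun S : Finset ι => {η : ι → Bool | ∀ i ∈ S, η i = true}) := by
  apply le_antisymm
  · refine iSup_le fun i => measurable_iff_comap_le.1 ?_
    refine @measurable_to_bool _ (MeasurableSpace.generateFrom _) _
      (MeasurableSpace.measurableSet_generateFrom ⟨{i}, ?_⟩)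
    ext η
    simp
  · refine MeasurableSpace.generateFrom_le ?_
    rintro _ ⟨S, rfl⟩
    exact (isPatternCylinder_true S).measurableSet

lemma isPiSystem_true (ι : Type*) :
    IsPiSystem (Set.range fun S : Finset ι => {η : ι → Bool | ∀ i ∈ S, η i = true}) := by
  classical
  rintro _ ⟨S, rfl⟩ _ ⟨T, rfl⟩ -
  refine ⟨S ∪ T, ?_⟩
  ext η
  simp only [Set.mem_inter_iff, Set.mem_ofPred_eq, Finset.mem_union, or_imp, forall_and]

lemma schonmann_isProbabilityMeasure (μ : Measure Cfg2) [IsProbabilityMeasure μ] :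
    IsProbabilityMeasure (schonmann μ) :=
  Measure.isProbabilityMeasure_map measurable_lineProj.aemeasurable

lemma IsPlusPhase.schonmann_shift {β h : ℝ} (hβ : 0 < β) {μ : Measure Cfg2}
    (hμ : IsPlusPhase β h μ) : (schonmann μ).map shiftSeq = schonmann μ := by
  classical
  have := hμ.1
  have := schonmann_isProbabilityMeasure μ
  have := Measure.isProbabilityMeasure_map (μ := schonmann μ)
    (measurable_shiftSeq (A := Bool)).aemeasurable
  refine ext_of_generate_finite _ (pi_eq_generateFrom_true ℤ) (isPiSystem_true ℤ) ?_ (by simp)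
  rintro _ ⟨S, rfl⟩
  have hm := (isPatternCylinder_true S).measurableSet
  rw [← measureReal_eq_measureReal_iff, map_measureReal_apply measurable_shiftSeq hm,
    schonmann_real _ hm, schonmann_real _ (measurable_shiftSeq hm)]
  have := hμ.translate_eq hβ (v := (1, 0)) (by simp [box]) (S.image fun i => (i, 0))
  simpa [shiftSeq, lineProj] using this

/-! ## One-dimensional conditional probabilities -/

lemma IsPatternCylinder.inter {ι : Type*} {A B : Set (ι → Bool)} (hA : IsPatternCylinder A)
    (hB : IsPatternCylinder B) (hne : (A ∩ B).Nonempty) : IsPatternCylinder (A ∩ B) := by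
  classical
  obtain ⟨S, f, rfl⟩ := hA
  obtain ⟨T, g, rfl⟩ := hB
  obtain ⟨ξ, hξ, hξ'⟩ := hne
  refine ⟨S ∪ T, ξ, ?_⟩
  ext η
  simp only [Set.mem_inter_iff, Set.mem_ofPred_eq, Finset.mem_union, or_imp, forall_and] at hξ hξ' ⊢
  exact and_congr (forall₂_congr fun i hi => by rw [hξ i hi])
    (forall₂_congr fun i hi => by rw [hξ' i hi])

/-- The event that the first `N` past coordinates agree with `ζ`. -/
def pastCyl (N : ℕ) (ζ : Past Bool) : Set (ZSeq Bool) := {η | ∀ k < N, restrictPast η k = ζ k}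

/-- The event that the spin at the origin is `a`. -/
abbrev originEvt (a : Bool) : Set (ZSeq Bool) := {η | η 0 = a}

lemma pastEvt_eq (n l : ℕ) (b : Bool) (ω : Past Bool) :
    pastEvt n l b ω = pastCyl (n + l) (splice (fun _ => b) ω n) := by
  ext η
  simp only [pastEvt, pastCyl, restrictPast, splice, Set.mem_ofPred_eq]
  constructor
  · rintro ⟨h1, h2⟩ k hk
    split_ifs with hkn
    · rw [h1 _ (by omega) (by omega)]
      congr 1
    · exact h2 _ (by omega) (by omega)
  · intro H
    constructor
    · intro i h1 h2
      have := H (i.natAbs - 1) (by omega)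
      rw [if_pos (by omega)] at this
      rw [← this]
      congr 1
      omega
    · intro i h1 h2
      have := H (i.natAbs - 1) (by omega)
      rw [if_neg (by omega)] at this
      rw [← this]
      congr 1
      omega

lemma pastCyl_congr {N : ℕ} {ζ ξ : Past Bool} (h : ∀ k < N, ζ k = ξ k) :
    pastCyl N ζ = pastCyl N ξ := by
  ext η
  exact forall₂_congr fun k hk => by rw [h k hk]

lemma isPatternCylinder_pastBlock (s : Finset ℕ) (ζ : Past Bool) :
    IsPatternCylinder {η : ZSeq Bool | ∀ k ∈ s, restrictPast η k = ζ k} := by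
  classical
  refine ⟨s.image fun k : ℕ => -((k : ℤ) + 1), fun i => ζ (i.natAbs - 1), ?_⟩
  ext η
  simp only [Set.mem_ofPred_eq, Finset.forall_mem_image, restrictPast]
  refine forall₂_congr fun k _ => ?_
  rw [show (-((k : ℤ) + 1)).natAbs - 1 = k by omega]

lemma isPatternCylinder_pastCyl (N : ℕ) (ζ : Past Bool) : IsPatternCylinder (pastCyl N ζ) := by
  simpa [pastCyl] using isPatternCylinder_pastBlock (Finset.range N) ζ

lemma isPatternCylinder_origin (a : Bool) : IsPatternCylinder (originEvt a) :=
  ⟨{0}, fun _ => a, by ext; simp⟩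

lemma isPatternCylinder_pastCyl_inter (N : ℕ) (ζ : Past Bool) (a : Bool) :
    IsPatternCylinder (pastCyl N ζ ∩ originEvt a) := by
  refine (isPatternCylinder_pastCyl N ζ).inter (isPatternCylinder_origin a)
    ⟨fun i => if i = 0 then a else ζ (i.natAbs - 1), fun k _ => ?_, by simp⟩
  simp only [restrictPast]
  rw [if_neg (by omega)]
  congr 1

lemma FiniteEnergy.le_inter {ι : Type*} {μ : Measure (ι → Bool)} [IsProbabilityMeasure μ] {c : ℝ}
    (hE : FiniteEnergy μ c) {U : Set (ι → Bool)} {x : ι} {a : Bool}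
    (hUa : IsPatternCylinder (U ∩ {η | η x = a})) (hx : ∀ η ∈ U, flipAt x η ∈ U) :
    c * μ.real U ≤ (1 + c) * μ.real (U ∩ {η | η x = a}) := by
  have h1 : U ⊆ (U ∩ {η | η x = a}) ∪ flipAt x ⁻¹' (U ∩ {η | η x = a}) := by
    intro η hη
    by_cases h : η x = a
    · exact Or.inl ⟨hη, h⟩
    · refine Or.inr ⟨hx η hη, ?_⟩
      change flipAt x η x = a
      rw [flipAt_same]
      cases a <;> simpa using h
  have h2 := (measureReal_mono h1 (μ := μ)).trans (measureReal_union_le _ _)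
  have h3 := hE x _ (hUa.flip x)
  have h4 : flipAt x ⁻¹' (flipAt x ⁻¹' (U ∩ {η | η x = a})) = U ∩ {η | η x = a} := by
    ext η
    rw [Set.mem_preimage, Set.mem_preimage, flipAt_flipAt]
  rw [h4] at h3
  have hc := hE x _ hUa
  by_cases hc0 : 0 ≤ c
  · have := mul_le_mul_of_nonneg_left h2 hc0
    linarith
  · have h5 : μ.real (U ∩ {η | η x = a}) ≤ μ.real U := measureReal_mono Set.inter_subset_left
    have h6 := measureReal_nonneg (μ := μ) (s := U ∩ {η | η x = a})
    nlinarith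

lemma FiniteEnergy.real_pos {ι : Type*} {μ : Measure (ι → Bool)} [IsProbabilityMeasure μ] {c : ℝ}
    (hc : 0 < c) (hE : FiniteEnergy μ c) {A : Set (ι → Bool)} (hA : IsPatternCylinder A) :
    0 < μ.real A := by
  classical
  obtain ⟨S, f, rfl⟩ := hA
  induction S using Finset.induction_on with
  | empty => simp
  | insert x S hx ih =>
    have e : {η : ι → Bool | ∀ i ∈ insert x S, η i = f i} =
        {η | ∀ i ∈ S, η i = f i} ∩ {η | η x = f x} := by
      ext η
      simp [and_comm]
    have := hE.le_inter (U := {η | ∀ i ∈ S, η i = f i}) (x := x) (a := f x)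
      (by rw [← e]; exact ⟨_, _, rfl⟩) fun η hη i hi => by
        rw [flipAt_ne (by rintro rfl; exact hx hi)]; exact hη i hi
    rw [← e] at this
    by_contra hn
    nlinarith [mul_pos hc ih]

lemma condProbR_eq {X : Type*} [MeasurableSpace X] (μ : Measure X) {A B : Set X}
    (hA : MeasurableSet A) : condProbR μ B A = μ.real (A ∩ B) / μ.real A := by
  rw [condProbR, cond_apply hA, ENNReal.toReal_mul, ENNReal.toReal_inv, inv_mul_eq_div]
  rfl

section Line

variable {ν : Measure (ZSeq Bool)} {c : ℝ}

/-- The conditional probability of the symbol `a` at the origin given `N` past coordinates. -/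
noncomputable def pastCond (ν : Measure (ZSeq Bool)) (a : Bool) (N : ℕ) (ζ : Past Bool) : ℝ :=
  condProbR ν (originEvt a) (pastCyl N ζ)

lemma pastCond_eq (a : Bool) (N : ℕ) (ζ : Past Bool) :
    pastCond ν a N ζ = ν.real (pastCyl N ζ ∩ originEvt a) / ν.real (pastCyl N ζ) :=
  condProbR_eq ν (isPatternCylinder_pastCyl N ζ).measurableSet

lemma pastCond_congr (a : Bool) {N : ℕ} {ζ ξ : Past Bool} (h : ∀ k < N, ζ k = ξ k) :
    pastCond ν a N ζ = pastCond ν a N ξ := by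
  rw [pastCond, pastCyl_congr h, pastCond]

lemma pastCond_le_one [IsProbabilityMeasure ν] (a : Bool) (N : ℕ) (ζ : Past Bool) : pastCond ν a N ζ ≤ 1 := by
  rw [pastCond_eq]
  exact div_le_one_of_le₀ (measureReal_mono Set.inter_subset_left) measureReal_nonneg

lemma pastCond_nonneg (a : Bool) (N : ℕ) (ζ : Past Bool) : 0 ≤ pastCond ν a N ζ := by
  rw [pastCond_eq]
  positivity

lemma pastCond_mul [IsProbabilityMeasure ν] (hc : 0 < c) (hE : FiniteEnergy ν c) (a : Bool) (N : ℕ) (ζ : Past Bool) :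
    pastCond ν a N ζ * ν.real (pastCyl N ζ) = ν.real (pastCyl N ζ ∩ originEvt a) := by
  rw [pastCond_eq, div_mul_cancel₀ _ (hE.real_pos hc (isPatternCylinder_pastCyl N ζ)).ne']

lemma pastCond_lower [IsProbabilityMeasure ν] (hc : 0 < c) (hE : FiniteEnergy ν c) (a : Bool) (N : ℕ) (ζ : Past Bool) :
    c / (1 + c) ≤ pastCond ν a N ζ := by
  have := hE.le_inter (isPatternCylinder_pastCyl_inter N ζ a) fun η hη k hk => by
    rw [restrictPast, flipAt_ne (by omega)]
    exact hη k hk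
  have h0 := hE.real_pos hc (isPatternCylinder_pastCyl N ζ)
  rw [pastCond_eq, div_le_div_iff₀ (by positivity) h0]
  linarith

lemma pastCond_false [IsProbabilityMeasure ν] (hc : 0 < c) (hE : FiniteEnergy ν c) (N : ℕ) (ζ : Past Bool) :
    pastCond ν false N ζ = 1 - pastCond ν true N ζ := by
  have h0 := hE.real_pos hc (isPatternCylinder_pastCyl N ζ)
  have h1 := measureReal_inter_add_sdiff (μ := ν) (s := pastCyl N ζ)
    (isPatternCylinder_origin true).measurableSet
  have h2 : pastCyl N ζ \ originEvt true = pastCyl N ζ ∩ originEvt false := by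
    ext η
    simp
  rw [h2] at h1
  rw [pastCond_eq, pastCond_eq]
  field_simp
  linarith

lemma pastCond_mono [IsProbabilityMeasure ν] (hc : 0 < c) (hE : FiniteEnergy ν c) (hL : LatticeCondition ν) {N M : ℕ}
    {ζ ξ : Past Bool} (h1 : ∀ k < N, ζ k = false ∨ (k < M ∧ ξ k = true))
    (h2 : ∀ k < M, ξ k = true ∨ (k < N ∧ ζ k = false)) :
    pastCond ν true N ζ ≤ pastCond ν true M ξ := by
  rw [pastCond_eq, pastCond_eq, div_le_div_iff₀
    (hE.real_pos hc (isPatternCylinder_pastCyl N ζ))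
    (hE.real_pos hc (isPatternCylinder_pastCyl M ξ)), mul_comm (ν.real (pastCyl M ξ ∩ _))]
  refine hL _ _ _ _ (isPatternCylinder_pastCyl_inter N ζ true) (isPatternCylinder_pastCyl M ξ)
    (isPatternCylinder_pastCyl N ζ) (isPatternCylinder_pastCyl_inter M ξ true) ?_
  rintro a ⟨ha, ha0⟩ b hb
  refine ⟨fun k hk => ?_, fun k hk => ?_, ?_⟩
  · change restrictPast a k ⊓ restrictPast b k = ζ k
    rcases h1 k hk with h | ⟨h, h'⟩
    · simp [ha k hk, h]
    · simp [ha k hk, hb k h, h']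
  · change restrictPast a k ⊔ restrictPast b k = ξ k
    rcases h2 k hk with h | ⟨h, h'⟩
    · simp [hb k hk, h]
    · simp [hb k hk, ha k h, h']
  · change a 0 ⊔ b 0 = true
    rw [show a 0 = true from ha0]
    simp

lemma continuous_of_eq_of_agree {f : Past Bool → ℝ} (n : ℕ)
    (h : ∀ ω ω' : Past Bool, (∀ k < n, ω k = ω' k) → f ω = f ω') : Continuous f := by
  refine continuous_iff_continuousAt.2 fun ω => ?_
  have : ∀ᶠ ω' : Past Bool in 𝓝 ω, ∀ k ∈ Finset.range n, ω k = ω' k := by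
    refine (Finset.eventually_all _).2 fun k _ => ?_
    have : {ω' : Past Bool | ω k = ω' k} = (fun ω' : Past Bool => ω' k) ⁻¹' {ω k} := by
      ext; simp [eq_comm]
    exact (this ▸ (isOpen_discrete _).preimage (continuous_apply k)).mem_nhds rfl
  refine (continuousAt_const (y := f ω)).congr ?_
  filter_upwards [this] with ω' h'
  exact h ω ω' fun k hk => h' k (Finset.mem_range.2 hk)

/-- The inner limits in the definition of `IsCondG`. -/
lemma IsCondG.exists_approx {b : Bool} {P : Bool → Past Bool → ℝ} (hP : IsCondG ν b P) :
    ∃ L : Bool → ℕ → Past Bool → ℝ,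
      (∀ a n ω, Tendsto (fun l => pastCond ν a (n + l) (splice (fun _ => b) ω n)) atTop
        (𝓝 (L a n ω))) ∧
      (∀ a ω, Tendsto (fun n => L a n ω) atTop (𝓝 (P a ω))) ∧
      ∀ a n, Continuous (L a n) := by
  choose L hL using hP
  simp only [pastEvt_eq] at hL
  refine ⟨fun a n ω => L a ω n, fun a n ω => (hL a ω).1 n, fun a ω => (hL a ω).2, fun a n => ?_⟩
  refine continuous_of_eq_of_agree n fun ω ω' h => tendsto_nhds_unique ((hL a ω).1 n) ?_
  have : splice (fun _ => b) ω n = splice (fun _ => b) ω' n := by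
    funext k
    by_cases hk : k < n
    · simp [splice, hk, h k hk]
    · simp [splice, hk]
  rw [this]
  exact (hL a ω').1 n

lemma IsCondG.false_eq [IsProbabilityMeasure ν] (hc : 0 < c) (hE : FiniteEnergy ν c) {b : Bool} {P : Bool → Past Bool → ℝ}
    (hP : IsCondG ν b P) (ω : Past Bool) : P false ω = 1 - P true ω := by
  obtain ⟨L, h1, h2, -⟩ := hP.exists_approx
  have h3 : ∀ n, L false n ω = 1 - L true n ω := fun n => by
    refine tendsto_nhds_unique (h1 false n ω) ?_
    simp only [pastCond_false hc hE]
    exact (h1 true n ω).const_sub 1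
  refine tendsto_nhds_unique (h2 false ω) ?_
  simp only [h3]
  exact (h2 true ω).const_sub 1

lemma IsCondG.pos [IsProbabilityMeasure ν] (hc : 0 < c) (hE : FiniteEnergy ν c) {b : Bool} {P : Bool → Past Bool → ℝ}
    (hP : IsCondG ν b P) (a : Bool) (ω : Past Bool) : 0 < P a ω := by
  obtain ⟨L, h1, h2, -⟩ := hP.exists_approx
  have : c / (1 + c) ≤ P a ω := ge_of_tendsto' (h2 a ω) fun n =>
    ge_of_tendsto' (h1 a n ω) fun l => pastCond_lower hc hE _ _ _
  exact lt_of_lt_of_le (by positivity) this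

lemma IsCondG.mem_Ioo [IsProbabilityMeasure ν] (hc : 0 < c) (hE : FiniteEnergy ν c) {b : Bool} {P : Bool → Past Bool → ℝ}
    (hP : IsCondG ν b P) (a : Bool) (ω : Past Bool) : P a ω ∈ Set.Ioo (0 : ℝ) 1 := by
  have h1 := hP.pos hc hE true ω
  have h2 := hP.pos hc hE false ω
  have h3 := hP.false_eq hc hE ω
  cases a <;> constructor <;> linarith

lemma IsCondG.measurable {b : Bool} {P : Bool → Past Bool → ℝ} (hP : IsCondG ν b P) (a : Bool) :
    Measurable (P a) := by
  obtain ⟨L, -, h2, h3⟩ := hP.exists_approx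
  exact measurable_of_tendsto_metrizable (fun n => (h3 a n).measurable)
    (tendsto_pi_nhds.2 fun ω => h2 a ω)

lemma IsCondG.isGFunction [IsProbabilityMeasure ν] (hc : 0 < c) (hE : FiniteEnergy ν c) {b : Bool}
    {P : Bool → Past Bool → ℝ} (hP : IsCondG ν b P) : IsGFunction P := by
  refine ⟨hP.measurable, fun ω => ⟨?_, fun a => Set.Ioo_subset_Icc_self (hP.mem_Ioo hc hE a ω)⟩⟩
  rw [Fintype.sum_bool, hP.false_eq hc hE]
  ring

/-- Approximation of `P^{+,+}` from above by local functions. -/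
lemma IsCondG.exists_upper [IsProbabilityMeasure ν] (hc : 0 < c) (hE : FiniteEnergy ν c) (hL : LatticeCondition ν)
    {P : Bool → Past Bool → ℝ} (hP : IsCondG ν true P) :
    ∃ L : ℕ → Past Bool → ℝ,
      (∀ n ω, Tendsto (fun l => pastCond ν true (n + l) (splice (fun _ => true) ω n)) atTop
        (𝓝 (L n ω))) ∧
      (∀ ω, Tendsto (fun n => L n ω) atTop (𝓝 (P true ω))) ∧ (∀ n, Continuous (L n)) ∧
      (∀ n ω, P true ω ≤ L n ω) ∧ ∀ n ω, pastCond ν true n ω ≤ L n ω := by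
  obtain ⟨L, h1, h2, h3⟩ := hP.exists_approx
  refine ⟨L true, h1 true, h2 true, h3 true, fun n ω => ?_, fun n ω => ?_⟩
  · refine Antitone.le_of_tendsto (antitone_nat_of_succ_le fun m => ?_) (h2 true ω) n
    refine le_of_tendsto_of_tendsto' (h1 true (m + 1) ω)
      ((tendsto_add_atTop_iff_nat 1).2 (h1 true m ω)) fun l => pastCond_mono hc hE hL ?_ ?_ <;>
    · intro k hk
      simp only [splice]
      grind
  · refine ge_of_tendsto' (h1 true n ω) fun l => pastCond_mono hc hE hL ?_ ?_ <;>
    · intro k hk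
      simp only [splice]
      grind

/-- Approximation of `P^{+,-}` from below by local functions. -/
lemma IsCondG.exists_lower [IsProbabilityMeasure ν] (hc : 0 < c) (hE : FiniteEnergy ν c) (hL : LatticeCondition ν)
    {P : Bool → Past Bool → ℝ} (hP : IsCondG ν false P) :
    ∃ L : ℕ → Past Bool → ℝ,
      (∀ ω, Tendsto (fun n => L n ω) atTop (𝓝 (P true ω))) ∧ (∀ n, Continuous (L n)) ∧
      (∀ n ω, L n ω ≤ P true ω) ∧ ∀ n ω, L n ω ≤ pastCond ν true n ω := by
  obtain ⟨L, h1, h2, h3⟩ := hP.exists_approx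
  refine ⟨L true, h2 true, h3 true, fun n ω => ?_, fun n ω => ?_⟩
  · refine Monotone.ge_of_tendsto (monotone_nat_of_le_succ fun m => ?_) (h2 true ω) n
    refine le_of_tendsto_of_tendsto' ((tendsto_add_atTop_iff_nat 1).2 (h1 true m ω))
      (h1 true (m + 1) ω) fun l => pastCond_mono hc hE hL ?_ ?_ <;>
    · intro k hk
      simp only [splice]
      grind
  · refine le_of_tendsto' (h1 true n ω) fun l => pastCond_mono hc hE hL ?_ ?_ <;>
    · intro k hk
      simp only [splice]
      grind

lemma IsCondG.le [IsProbabilityMeasure ν] (hc : 0 < c) (hE : FiniteEnergy ν c) (hL : LatticeCondition ν)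
    {Pp Pm : Bool → Past Bool → ℝ} (hPp : IsCondG ν true Pp) (hPm : IsCondG ν false Pm)
    (ω : Past Bool) : Pm true ω ≤ Pp true ω := by
  obtain ⟨U, -, hU, -, -, hU'⟩ := hPp.exists_upper hc hE hL
  obtain ⟨L, hL1, -, -, hL'⟩ := hPm.exists_lower hc hE hL
  exact le_of_tendsto_of_tendsto' (hL1 ω) (hU ω) fun n => (hL' n ω).trans (hU' n ω)

lemma IsCondG.continuousAt [IsProbabilityMeasure ν] (hc : 0 < c) (hE : FiniteEnergy ν c) (hL : LatticeCondition ν)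
    {Pp Pm : Bool → Past Bool → ℝ} (hPp : IsCondG ν true Pp) (hPm : IsCondG ν false Pm)
    {ω : Past Bool} (h : Pp true ω = Pm true ω) (a : Bool) : ContinuousAt (Pm a) ω := by
  have key : ContinuousAt (Pm true) ω := by
    obtain ⟨U, -, hU, hUc, hU', -⟩ := hPp.exists_upper hc hE hL
    obtain ⟨L, hL1, hLc, hL', -⟩ := hPm.exists_lower hc hE hL
    refine tendsto_order.2 ⟨fun r hr => ?_, fun r hr => ?_⟩
    · obtain ⟨n, hn⟩ := ((hL1 ω).eventually (lt_mem_nhds hr)).exists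
      filter_upwards [(hLc n).continuousAt.eventually (lt_mem_nhds hn)] with ω' hω'
      exact hω'.trans_le (hL' n ω')
    · rw [← h] at hr
      obtain ⟨n, hn⟩ := ((hU ω).eventually (gt_mem_nhds hr)).exists
      filter_upwards [(hUc n).continuousAt.eventually (gt_mem_nhds hn)] with ω' hω'
      exact ((hPp.le hc hE hL hPm ω').trans (hU' n ω')).trans_lt hω'
  cases a
  · rw [show Pm false = fun ω => 1 - Pm true ω from funext fun ω => hPm.false_eq hc hE ω]
    exact continuousAt_const.sub key
  · exact key

end Line

/-! ### Limits of conditional probabilities are versions of the conditional expectation -/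

lemma continuous_pastCond (ν : Measure (ZSeq Bool)) (a : Bool) (n : ℕ) :
    Continuous (pastCond ν a n) :=
  continuous_of_eq_of_agree n fun _ _ h => pastCond_congr a h

lemma integrable_comp_restrictPast (ν : Measure (ZSeq Bool)) [IsProbabilityMeasure ν]
    {f : Past Bool → ℝ} (hf : Measurable f) (h0 : ∀ ω, 0 ≤ f ω) (h1 : ∀ ω, f ω ≤ 1) :
    Integrable (fun η => f (restrictPast η)) ν :=
  Integrable.of_bound (hf.comp measurable_restrictPast).aestronglyMeasurable 1
    (Eventually.of_forall fun η => by rw [Real.norm_of_nonneg (h0 _)]; exact h1 _)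

lemma pastCyl_zero (ζ : Past Bool) : pastCyl 0 ζ = Set.univ := by
  ext
  simp [pastCyl]

lemma pastCyl_update (k : ℕ) (ζ : Past Bool) (b : Bool) :
    pastCyl (k + 1) (Function.update ζ k b) = pastCyl k ζ ∩ {η | restrictPast η k = b} := by
  ext η
  simp only [pastCyl, Set.mem_inter_iff, Set.mem_ofPred_eq, Nat.lt_succ_iff_lt_or_eq, or_imp,
    forall_and, forall_eq, Function.update_self]
  refine and_congr_left fun _ => forall₂_congr fun j hj => ?_
  rw [Function.update_of_ne hj.ne]

lemma setIntegral_pastCond {ν : Measure (ZSeq Bool)} [IsProbabilityMeasure ν] {c : ℝ}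
    (hc : 0 < c) (hE : FiniteEnergy ν c) (a : Bool) (n : ℕ) {E : Set (Past Bool)}
    (hEm : MeasurableSet E) (hEn : ∀ ω ω', (∀ k < n, ω k = ω' k) → ω ∈ E → ω' ∈ E) (d : ℕ) :
    ∀ k, k + d = n → ∀ ω : Past Bool,
      ∫ η in restrictPast ⁻¹' E ∩ pastCyl k ω, pastCond ν a n (restrictPast η) ∂ν =
        ν.real (restrictPast ⁻¹' E ∩ pastCyl k ω ∩ originEvt a) := by
  have hE' : MeasurableSet (restrictPast ⁻¹' E : Set (ZSeq Bool)) := measurable_restrictPast hEm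
  have hO := (isPatternCylinder_origin a).measurableSet
  have hC : ∀ k ω, MeasurableSet (pastCyl k ω) := fun k ω =>
    (isPatternCylinder_pastCyl k ω).measurableSet
  induction d with
  | zero =>
    rintro k rfl ω
    rw [Nat.add_zero] at *
    by_cases h : ω ∈ E
    · have e : restrictPast ⁻¹' E ∩ pastCyl k ω = pastCyl k ω :=
        Set.inter_eq_right.2 fun η hη => hEn ω _ (fun j hj => (hη j hj).symm) h
      rw [e, setIntegral_congr_fun (hC k ω) (g := fun _ => pastCond ν a k ω)
        fun η hη => pastCond_congr a hη, setIntegral_const, smul_eq_mul, mul_comm,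
        pastCond_mul hc hE]
    · have e : restrictPast ⁻¹' E ∩ pastCyl k ω = ∅ :=
        Set.eq_empty_of_forall_notMem fun η hη => h (hEn _ _ hη.2 hη.1)
      simp [e]
  | succ d ih =>
    intro k hk ω
    have hm : MeasurableSet {η : ZSeq Bool | restrictPast η k = true} :=
      (measurable_pi_apply k).comp measurable_restrictPast (measurableSet_singleton true)
    have ht : ∀ X : Set (ZSeq Bool), restrictPast ⁻¹' E ∩ pastCyl k ω ∩ X =
        (restrictPast ⁻¹' E ∩ pastCyl (k + 1) (Function.update ω k true) ∩ X) ∪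
        (restrictPast ⁻¹' E ∩ pastCyl (k + 1) (Function.update ω k false) ∩ X) := by
      intro X
      ext η
      simp only [pastCyl_update, Set.mem_inter_iff, Set.mem_union, Set.mem_ofPred_eq]
      cases restrictPast η k <;> simp
    have hd : ∀ X : Set (ZSeq Bool), Disjoint
        (restrictPast ⁻¹' E ∩ pastCyl (k + 1) (Function.update ω k true) ∩ X)
        (restrictPast ⁻¹' E ∩ pastCyl (k + 1) (Function.update ω k false) ∩ X) := by
      intro X
      refine Set.disjoint_left.2 fun η h1 h2 => ?_
      rw [pastCyl_update] at h1 h2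
      have h1' : restrictPast η k = true := h1.1.2.2
      have h2' : restrictPast η k = false := h2.1.2.2
      simp [h1'] at h2'
    have hI : Integrable (fun η => pastCond ν a n (restrictPast η)) ν :=
      integrable_comp_restrictPast ν (continuous_pastCond ν a n).measurable (pastCond_nonneg a n)
        (pastCond_le_one a n)
    have ht' := ht Set.univ
    have hd' := hd Set.univ
    simp only [Set.inter_univ] at ht' hd'
    rw [ht (originEvt a), measureReal_union (hd _) ((hE'.inter (hC _ _)).inter hO), ht',
      setIntegral_union hd' (hE'.inter (hC _ _)) hI.integrableOn hI.integrableOn,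
      ih (k + 1) (by omega), ih (k + 1) (by omega)]

lemma ae_eq_condExp_of_tendsto_pastCond {ν : Measure (ZSeq Bool)} [IsProbabilityMeasure ν] {c : ℝ}
    (hc : 0 < c) (hE : FiniteEnergy ν c) (a : Bool) {Q : Past Bool → ℝ}
    (hQ : ∀ ω, Tendsto (fun n => pastCond ν a n ω) atTop (𝓝 (Q ω))) :
    (fun η => Q (restrictPast η))
      =ᵐ[ν] ν[Set.indicator {η : ZSeq Bool | η 0 = a} (fun _ => (1 : ℝ)) | pastSigma Bool] := by
  have hQm : Measurable Q := measurable_of_tendsto_metrizable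
    (fun n => (continuous_pastCond ν a n).measurable) (tendsto_pi_nhds.2 hQ)
  have hQ0 : ∀ ω, 0 ≤ Q ω := fun ω => ge_of_tendsto' (hQ ω) fun n => pastCond_nonneg a n ω
  have hQ1 : ∀ ω, Q ω ≤ 1 := fun ω => le_of_tendsto' (hQ ω) fun n => pastCond_le_one a n ω
  have hI := integrable_comp_restrictPast ν hQm hQ0 hQ1
  have hO := (isPatternCylinder_origin a).measurableSet
  have cyl : ∀ S : Finset ℕ,
      ∫ η in restrictPast ⁻¹' {ζ | ∀ i ∈ S, ζ i = true}, Q (restrictPast η) ∂ν =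
        ν.real (restrictPast ⁻¹' {ζ | ∀ i ∈ S, ζ i = true} ∩ originEvt a) := by
    intro S
    obtain ⟨N, hN⟩ := S.exists_nat_subset_range
    have h1 : Tendsto (fun n => ∫ η in restrictPast ⁻¹' {ζ | ∀ i ∈ S, ζ i = true},
        pastCond ν a n (restrictPast η) ∂ν) atTop
        (𝓝 (∫ η in restrictPast ⁻¹' {ζ | ∀ i ∈ S, ζ i = true}, Q (restrictPast η) ∂ν)) := by
      refine tendsto_integral_of_dominated_convergence (fun _ => 1) (fun n =>
        ((continuous_pastCond ν a n).measurable.comp measurable_restrictPast).aestronglyMeasurable)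
        (integrable_const _) (fun n => Eventually.of_forall fun η => ?_)
        (Eventually.of_forall fun η => hQ _)
      rw [Real.norm_of_nonneg (pastCond_nonneg _ _ _)]
      exact pastCond_le_one _ _ _
    refine tendsto_nhds_unique h1 (tendsto_const_nhds.congr' ?_)
    filter_upwards [eventually_ge_atTop N] with n hn
    have := setIntegral_pastCond hc hE a n (isPatternCylinder_true S).measurableSet
      (fun ω ω' h hω i hi => by
        rw [← h i ((Finset.mem_range.1 (hN hi)).trans_le hn)]; exact hω i hi)
      n 0 (by simp) (fun _ => true)
    simpa only [pastCyl_zero, Set.inter_univ] using this.symm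
  have lint : ∀ {E : Set (Past Bool)}, MeasurableSet E →
      (ν.withDensity fun η => ENNReal.ofReal (Q (restrictPast η))).map restrictPast E =
        ENNReal.ofReal (∫ η in restrictPast ⁻¹' E, Q (restrictPast η) ∂ν) := fun hEm => by
    rw [Measure.map_apply measurable_restrictPast hEm,
      withDensity_apply _ (measurable_restrictPast hEm),
      ofReal_integral_eq_lintegral_ofReal hI.integrableOn (Eventually.of_forall fun _ => hQ0 _)]
  have rest : ∀ {E : Set (Past Bool)}, MeasurableSet E →
      (ν.restrict (originEvt a)).map restrictPast E =
        ENNReal.ofReal (ν.real (restrictPast ⁻¹' E ∩ originEvt a)) := fun hEm => by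
    rw [Measure.map_apply measurable_restrictPast hEm,
      Measure.restrict_apply (measurable_restrictPast hEm), ofReal_measureReal]
  have key : (ν.restrict (originEvt a)).map restrictPast =
      (ν.withDensity fun η => ENNReal.ofReal (Q (restrictPast η))).map restrictPast := by
    refine ext_of_generate_finite _ (pi_eq_generateFrom_true ℕ) (isPiSystem_true ℕ) ?_ ?_
    · rintro _ ⟨S, rfl⟩
      have hm := (isPatternCylinder_true S).measurableSet
      rw [rest hm, lint hm, cyl S]
    · have := cyl ∅
      rw [rest MeasurableSet.univ, lint MeasurableSet.univ]
      simpa using congrArg ENNReal.ofReal this.symm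
  refine ae_eq_condExp_of_forall_setIntegral_eq measurable_restrictPast.comap_le
    ((integrable_const _).indicator hO) (fun s _ _ => hI.integrableOn) ?_
    (hQm.comp (comap_measurable _)).aestronglyMeasurable
  rintro _ ⟨E, hEm, rfl⟩ -
  have h2 := congrArg (fun m => m E) key
  simp only [rest hEm, lint hEm] at h2
  rw [ENNReal.ofReal_eq_ofReal_iff measureReal_nonneg
    (integral_nonneg fun η => hQ0 _)] at h2
  rw [← h2, setIntegral_indicator hO, setIntegral_const, smul_eq_mul, mul_one]

/-! ### The correlation inequality for the plus-conditioned g-function -/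

/-- Extension of a finite past by `+1`. -/
def extendPast {n : ℕ} (τ : Fin n → Bool) : Past Bool :=
  fun k => if h : k < n then τ ⟨k, h⟩ else true

lemma extendPast_mono {n : ℕ} {τ τ' : Fin n → Bool} (h : τ ≤ τ') (k : ℕ) :
    extendPast τ k = false ∨ extendPast τ' k = true := by
  unfold extendPast
  split_ifs with hk
  · have := h ⟨k, hk⟩
    revert this
    cases τ ⟨k, hk⟩ <;> cases τ' ⟨k, hk⟩ <;> simp
  · exact Or.inr rfl

lemma extendPast_inf {n : ℕ} (τ τ' : Fin n → Bool) (k : ℕ) :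
    extendPast (τ ⊓ τ') k = extendPast τ k ⊓ extendPast τ' k := by
  unfold extendPast
  split_ifs <;> simp

lemma extendPast_sup {n : ℕ} (τ τ' : Fin n → Bool) (k : ℕ) :
    extendPast (τ ⊔ τ') k = extendPast τ k ⊔ extendPast τ' k := by
  unfold extendPast
  split_ifs <;> simp

lemma extendPast_of_le {n : ℕ} (τ : Fin n → Bool) {k : ℕ} (h : n ≤ k) :
    extendPast τ k = true := by
  simp [extendPast, h]

lemma splice_eq_extendPast (n : ℕ) (ω : Past Bool) :
    splice (fun _ => true) ω n = extendPast fun i : Fin n => ω i := by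
  funext k
  simp [splice, extendPast]

lemma mem_pastCyl_extendPast {n : ℕ} {τ : Fin n → Bool} {η : ZSeq Bool} :
    η ∈ pastCyl n (extendPast τ) ↔ (fun i : Fin n => restrictPast η i) = τ := by
  simp only [pastCyl, extendPast, Set.mem_ofPred_eq, funext_iff]
  exact ⟨fun H i => by rw [H i i.2, dif_pos i.2],
    fun H k hk => by rw [dif_pos hk]; exact H ⟨k, hk⟩⟩

lemma pastCyl_add_extendPast {n l : ℕ} (τ : Fin n → Bool) :
    pastCyl (n + l) (extendPast τ) = pastCyl n (extendPast τ) ∩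
      {η | ∀ k ∈ Finset.Ico n (n + l), restrictPast η k = true} := by
  ext η
  simp only [pastCyl, extendPast, Set.mem_inter_iff, Set.mem_ofPred_eq, Finset.mem_Ico]
  grind

lemma sum_pastCyl_inter (ν : Measure (ZSeq Bool)) [IsProbabilityMeasure ν] (n : ℕ)
    (W : Set (ZSeq Bool)) (hW : MeasurableSet W) :
    ∑ τ : Fin n → Bool, ν.real (pastCyl n (extendPast τ) ∩ W) = ν.real W := by
  rw [← measureReal_biUnion_finset]
  · congr 1
    ext η
    simp [mem_pastCyl_extendPast]
  · intro τ _ τ' _ hne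
    refine Set.disjoint_left.2 fun η h1 h2 => hne ?_
    rw [← mem_pastCyl_extendPast.1 h1.1, ← mem_pastCyl_extendPast.1 h2.1]
  · exact fun τ _ => (isPatternCylinder_pastCyl n _).measurableSet.inter hW

lemma integral_splice (ν : Measure (ZSeq Bool)) [IsProbabilityMeasure ν] (n : ℕ)
    (f : Past Bool → ℝ) :
    ∫ η, f (splice (fun _ => true) (restrictPast η) n) ∂ν =
      ∑ τ : Fin n → Bool, ν.real (pastCyl n (extendPast τ)) * f (extendPast τ) := by
  have hm : Measurable fun (η : ZSeq Bool) (i : Fin n) => restrictPast η i :=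
    measurable_pi_lambda _ fun i => measurable_pi_apply (-((i : ℤ) + 1))
  simp only [splice_eq_extendPast]
  have := Measure.isProbabilityMeasure_map (μ := ν) hm.aemeasurable
  rw [← integral_map (φ := fun (η : ZSeq Bool) (i : Fin n) => restrictPast η i)
    (f := fun τ => f (extendPast τ)) hm.aemeasurable
    (measurable_of_finite _).aestronglyMeasurable, integral_fintype Integrable.of_finite]
  refine Finset.sum_congr rfl fun τ _ => ?_
  rw [map_measureReal_apply hm (measurableSet_singleton τ), smul_eq_mul]
  congr 2
  ext η
  exact mem_pastCyl_extendPast.symm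

lemma integral_pastCond_splice_le {ν : Measure (ZSeq Bool)} [IsProbabilityMeasure ν] {c : ℝ}
    (hc : 0 < c) (hE : FiniteEnergy ν c) (hL : LatticeCondition ν) (n l : ℕ) {q : ℝ}
    (hq : ν.real ({η | ∀ k ∈ Finset.Ico n (n + l), restrictPast η k = true} ∩ originEvt true) ≤
      ν.real {η | ∀ k ∈ Finset.Ico n (n + l), restrictPast η k = true} * q) :
    ∫ η, pastCond ν true (n + l) (splice (fun _ => true) (restrictPast η) n) ∂ν ≤ q := by
  have hVp := isPatternCylinder_pastBlock (Finset.Ico n (n + l)) fun _ => true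
  set V : Set (ZSeq Bool) := {η | ∀ k ∈ Finset.Ico n (n + l), restrictPast η k = true} with hV
  have hV0 : 0 < ν.real V := hE.real_pos hc hVp
  have hm0 : ∀ N (τ : Fin n → Bool), 0 < ν.real (pastCyl N (extendPast τ)) := fun N τ =>
    hE.real_pos hc (isPatternCylinder_pastCyl _ _)
  have key := fkg (μ := fun τ : Fin n → Bool => ν.real (pastCyl n (extendPast τ)))
    (f := fun τ => pastCond ν true (n + l) (extendPast τ))
    (g := fun τ => ν.real (pastCyl (n + l) (extendPast τ)) / ν.real (pastCyl n (extendPast τ)))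
    (fun τ => (hm0 n τ).le) (fun τ => pastCond_nonneg _ _ _)
    (fun τ => div_nonneg (hm0 _ τ).le (hm0 _ τ).le)
    (fun τ τ' hτ => pastCond_mono hc hE hL ?_ ?_)
    (fun τ τ' hτ => ?_) (fun τ τ' => ?_)
  · have e1 := sum_pastCyl_inter ν n Set.univ MeasurableSet.univ
    have e2 := sum_pastCyl_inter ν n V hVp.measurableSet
    have e3 := sum_pastCyl_inter ν n (V ∩ originEvt true)
      (hVp.measurableSet.inter (isPatternCylinder_origin true).measurableSet)
    simp only [Set.inter_univ, probReal_univ] at e1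
    have e4 : ∀ τ : Fin n → Bool, ν.real (pastCyl n (extendPast τ)) *
        (ν.real (pastCyl (n + l) (extendPast τ)) / ν.real (pastCyl n (extendPast τ))) =
        ν.real (pastCyl n (extendPast τ) ∩ V) := fun τ => by
      rw [mul_div_cancel₀ _ (hm0 n τ).ne', pastCyl_add_extendPast]
    have e5 : ∀ τ : Fin n → Bool, ν.real (pastCyl n (extendPast τ)) *
        (pastCond ν true (n + l) (extendPast τ) *
          (ν.real (pastCyl (n + l) (extendPast τ)) / ν.real (pastCyl n (extendPast τ)))) =
        ν.real (pastCyl n (extendPast τ) ∩ (V ∩ originEvt true)) := fun τ => by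
      rw [mul_left_comm, mul_div_cancel₀ _ (hm0 n τ).ne', pastCond_mul hc hE,
        pastCyl_add_extendPast, Set.inter_assoc]
    simp only [e4, e5, e1, e2, e3] at key
    rw [← integral_splice ν n (pastCond ν true (n + l)), one_mul] at key
    refine le_of_mul_le_mul_right ?_ hV0
    linarith
  · exact fun k hk => (extendPast_mono hτ k).imp_right fun h => ⟨hk, h⟩
  · exact fun k hk => (extendPast_mono hτ k).symm.imp_right fun h => ⟨hk, h⟩
  · change _ / _ ≤ _ / _
    rw [div_le_div_iff₀ (hm0 n τ) (hm0 n τ'), mul_comm (ν.real (pastCyl (n + l) (extendPast τ')))]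
    refine hL _ _ _ _ (isPatternCylinder_pastCyl _ _) (isPatternCylinder_pastCyl _ _)
      (isPatternCylinder_pastCyl _ _) (isPatternCylinder_pastCyl _ _) fun a ha b hb =>
      ⟨fun k hk => ?_, fun k hk => ?_⟩
    · change restrictPast a k ⊓ restrictPast b k = _
      rw [ha k (by omega), hb k hk, ← extendPast_inf, inf_of_le_left hτ]
    · change restrictPast a k ⊔ restrictPast b k = _
      rw [ha k hk]
      by_cases hkn : k < n
      · rw [hb k hkn, ← extendPast_sup, sup_of_le_right hτ]
      · rw [extendPast_of_le _ (not_lt.1 hkn), extendPast_of_le _ (not_lt.1 hkn)]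
        simp
  · refine hL _ _ _ _ (isPatternCylinder_pastCyl _ _) (isPatternCylinder_pastCyl _ _)
      (isPatternCylinder_pastCyl _ _) (isPatternCylinder_pastCyl _ _) fun a ha b hb =>
      ⟨fun k hk => ?_, fun k hk => ?_⟩
    · change restrictPast a k ⊓ restrictPast b k = _
      rw [ha k hk, hb k hk, extendPast_inf]
    · change restrictPast a k ⊔ restrictPast b k = _
      rw [ha k hk, hb k hk, extendPast_sup]

lemma IsCondG.integral_le {ν : Measure (ZSeq Bool)} [IsProbabilityMeasure ν] {c : ℝ}
    (hc : 0 < c) (hE : FiniteEnergy ν c) (hL : LatticeCondition ν) {P : Bool → Past Bool → ℝ}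
    (hP : IsCondG ν true P) {q : ℕ → ℝ} {r : ℝ} (hqr : Tendsto q atTop (𝓝 r))
    (hq : ∀ n l : ℕ,
      ν.real ({η | ∀ k ∈ Finset.Ico n (n + l), restrictPast η k = true} ∩ originEvt true) ≤
        ν.real {η | ∀ k ∈ Finset.Ico n (n + l), restrictPast η k = true} * q n) :
    ∫ η, P true (restrictPast η) ∂ν ≤ r := by
  obtain ⟨L, h1, -, h3, h4, -⟩ := hP.exists_upper hc hE hL
  have h0 : ∀ n ω, 0 ≤ L n ω := fun n ω => ge_of_tendsto' (h1 n ω) fun l => pastCond_nonneg _ _ _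
  have h5 : ∀ n ω, L n ω ≤ 1 := fun n ω => le_of_tendsto' (h1 n ω) fun l => pastCond_le_one _ _ _
  refine ge_of_tendsto' hqr fun n => ?_
  calc ∫ η, P true (restrictPast η) ∂ν
      ≤ ∫ η, L n (restrictPast η) ∂ν := by
        refine integral_mono
          (integrable_comp_restrictPast ν (hP.measurable true)
            (fun ω => (hP.mem_Ioo hc hE true ω).1.le) fun ω => (hP.mem_Ioo hc hE true ω).2.le)
          (integrable_comp_restrictPast ν (h3 n).measurable (h0 n) (h5 n)) fun η => h4 n _
    _ ≤ q n := by
        refine le_of_tendsto' (f := fun l => ∫ η, pastCond ν true (n + l)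
          (splice (fun _ => true) (restrictPast η) n) ∂ν) (x := atTop)
          (tendsto_integral_of_dominated_convergence (fun _ => 1) (fun l => ?_)
            (integrable_const _) (fun l => Eventually.of_forall fun η => ?_)
            (Eventually.of_forall fun η => h1 n _))
          fun l => integral_pastCond_splice_le hc hE hL n l (hq n l)
        · refine (((continuous_of_eq_of_agree n fun ω ω' h => pastCond_congr true fun k _ => ?_ :
            Continuous fun ω => pastCond ν true (n + l) (splice (fun _ => true) ω n)).measurable).comp
            measurable_restrictPast).aestronglyMeasurable
          simp only [splice]
          split_ifs with hk
          · exact h k hk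
          · rfl
        · rw [Real.norm_of_nonneg (pastCond_nonneg _ _ _)]
          exact pastCond_le_one _ _ _

lemma IsGMeasure.ae_eq_plus {ν : Measure (ZSeq Bool)} [IsProbabilityMeasure ν] {c : ℝ}
    (hc : 0 < c) (hE : FiniteEnergy ν c) (hL : LatticeCondition ν) {Pp Pm : Bool → Past Bool → ℝ}
    (hPp : IsCondG ν true Pp) (hPm : IsCondG ν false Pm) (hg : IsGMeasure ν Pm)
    (hI : ∫ η, Pp true (restrictPast η) ∂ν ≤ ν.real (originEvt true)) :
    ∀ᵐ ω ∂(ν.map restrictPast), ∀ a, Pp a ω = Pm a ω := by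
  have hO := (isPatternCylinder_origin true).measurableSet
  have hi : ∀ {b P}, IsCondG ν b P → Integrable (fun η => P true (restrictPast η)) ν := fun hP =>
    integrable_comp_restrictPast ν (hP.measurable true)
      (fun ω => (hP.mem_Ioo hc hE true ω).1.le) fun ω => (hP.mem_Ioo hc hE true ω).2.le
  have hm : pastSigma Bool ≤ MeasurableSpace.pi := measurable_restrictPast.comap_le
  have e : ∫ η, Pm true (restrictPast η) ∂ν = ν.real (originEvt true) := by
    rw [integral_congr_ae (hg.2.2 true), integral_condExp hm,
      integral_indicator hO, setIntegral_const, smul_eq_mul, mul_one]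
  have hle : ∀ η : ZSeq Bool, Pm true (restrictPast η) ≤ Pp true (restrictPast η) := fun η =>
    hPp.le hc hE hL hPm _
  have h := (integral_eq_iff_of_ae_le (hi hPm) (hi hPp) (Eventually.of_forall hle)).1
    (le_antisymm (integral_mono (hi hPm) (hi hPp) hle) (e ▸ hI))
  have hs : MeasurableSet {ω | Pp true ω = Pm true ω} :=
    measurableSet_eq_fun (hPp.measurable true) (hPm.measurable true)
  have h' : ∀ᵐ ω ∂(ν.map restrictPast), Pp true ω = Pm true ω := by
    rw [ae_map_iff measurable_restrictPast.aemeasurable hs]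
    filter_upwards [h] with η hη using hη.symm
  filter_upwards [h'] with ω hω a
  cases a
  · rw [hPp.false_eq hc hE, hPm.false_eq hc hE, hω]
  · exact hω

lemma IsCondG.tendsto_pastCond {ν : Measure (ZSeq Bool)} [IsProbabilityMeasure ν] {c : ℝ}
    (hc : 0 < c) (hE : FiniteEnergy ν c) (hL : LatticeCondition ν) {P : Bool → Past Bool → ℝ}
    (hPp : IsCondG ν true P) (hPm : IsCondG ν false P) (a : Bool) (ω : Past Bool) :
    Tendsto (fun n => pastCond ν a n ω) atTop (𝓝 (P a ω)) := by
  obtain ⟨U, -, hU, -, -, hU'⟩ := hPp.exists_upper hc hE hL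
  obtain ⟨L, hL1, -, -, hL'⟩ := hPm.exists_lower hc hE hL
  have h := tendsto_of_tendsto_of_tendsto_of_le_of_le (hL1 ω) (hU ω) (fun n => hL' n ω)
    fun n => hU' n ω
  cases a
  · rw [hPp.false_eq hc hE]
    simp only [pastCond_false hc hE]
    exact h.const_sub 1
  · exact h

lemma IsPlusPhase.schonmann_block_inter_le {β h : ℝ} (hβ : 0 < β) {μ : Measure Cfg2}
    (hμ : IsPlusPhase β h μ) (n l : ℕ) :
    (schonmann μ).real
        ({η | ∀ k ∈ Finset.Ico n (n + l), restrictPast η k = true} ∩ originEvt true) ≤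
      (schonmann μ).real {η | ∀ k ∈ Finset.Ico n (n + l), restrictPast η k = true} *
        (plusFV β h (box n)).real {ω | ω (0, 0) = true} := by
  classical
  have hV := (isPatternCylinder_pastBlock (Finset.Ico n (n + l)) fun _ => true).measurableSet
  rw [schonmann_real _ (hV.inter (isPatternCylinder_origin true).measurableSet),
    schonmann_real _ hV]
  have := hμ.inter_le hβ n (S := {(0, 0)})
    (T := (Finset.Ico n (n + l)).image fun k : ℕ => (-((k : ℤ) + 1), (0 : ℤ))) (by
      simp only [Finset.forall_mem_image, Finset.mem_Ico, box, Finset.mem_product, Finset.mem_Icc]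
      intro k hk
      omega)
  simp only [Finset.forall_mem_image, Finset.mem_singleton, forall_eq] at this
  rwa [Set.inter_comm] at this

/-- Let `β > 0`, `h ∈ ℝ`. (i) If `P^{+,+} = P^{+,-}` then `ν_{β,h}^+` is a
regular g-measure. (ii) If `ν_{β,h}^+` is consistent with `P^{+,-}` then `P^{+,+} = P^{+,-}`
almost surely and `ν_{β,h}^+` is an almost regular g-measure. -/
theorem regular_and_almost_regular_criteria
    (β h : ℝ) (hβ : 0 < β) (μp : Measure Cfg2) (hμp : IsPlusPhase β h μp)
    (Pp Pm : Bool → Past Bool → ℝ)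
    (hPp : IsCondG (schonmann μp) true Pp) (hPm : IsCondG (schonmann μp) false Pm) :
    (Pp = Pm →
      ∃ P : Bool → Past Bool → ℝ, IsGFunction P ∧ (∀ a, Continuous (P a)) ∧
        (∀ a ω, P a ω ∈ Set.Ioo (0 : ℝ) 1) ∧ IsGMeasure (schonmann μp) P) ∧
    (IsGMeasure (schonmann μp) Pm →
      (∀ᵐ ω ∂((schonmann μp).map restrictPast), ∀ a, Pp a ω = Pm a ω) ∧
      ∃ P : Bool → Past Bool → ℝ, IsGFunction P ∧
        (∀ a ω, P a ω ∈ Set.Ioo (0 : ℝ) 1) ∧ IsGMeasure (schonmann μp) P ∧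
        (∀ᵐ ω ∂((schonmann μp).map restrictPast), ∀ a, ContinuousAt (P a) ω)) := by
  have hμ := hμp.1
  have hν := schonmann_isProbabilityMeasure μp
  have hc : 0 < energyConst β h := Real.exp_pos _
  have hE := (hμp.finiteEnergy hβ).schonmann
  have hL := (hμp.latticeCondition hβ).schonmann
  refine ⟨?_, fun hg => ?_⟩
  · rintro rfl
    exact ⟨Pp, hPp.isGFunction hc hE,
      fun a => continuous_iff_continuousAt.2 fun ω => hPp.continuousAt hc hE hL hPm rfl a,
      fun a ω => hPp.mem_Ioo hc hE a ω, hν, hμp.schonmann_shift hβ,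
      fun a => ae_eq_condExp_of_tendsto_pastCond hc hE a (hPp.tendsto_pastCond hc hE hL hPm a)⟩
  · have hO : IsPatternCylinder {ω : Cfg2 | ω (0, 0) = true} :=
      (isPatternCylinder_origin true).lineProj
    have hae := hg.ae_eq_plus hc hE hL hPp hPm (hPp.integral_le hc hE hL (by
      rw [schonmann_real _ (isPatternCylinder_origin true).measurableSet]
      exact hμp.tendsto hO) (hμp.schonmann_block_inter_le hβ))
    refine ⟨hae, Pm, hPm.isGFunction hc hE, fun a ω => hPm.mem_Ioo hc hE a ω, hg, ?_⟩
    filter_upwards [hae] with ω hω a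
    exact hPp.continuousAt hc hE hL hPm (hω true) a
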